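/- arXiv:2605.29103 — 8 statements merged into one kernel-verified Lean document; each statement's English description precedes it below -/
import Mathlib

section
/- Let n ≥ 3 and label the elements of [2n] as f_1,…,f_n, g_1,…,g_n. Let Δ(n) be the simple graph on these vertices with edges {f_i,f_j} for all i ≠ j and {f_i,g_j} for all i ≠ j; its cliques are exactly the nonempty subsets of {f_1,…,f_n} together with the sets {g_i} ∪ σ for σ ⊆ {f_1,…,f_n}∖{f_i}. Let X consist of all nonempty cliques of Δ(n) except those of the forms: {g_1} ∪ σ with σ ⊆ {f_2,…,f_n} and |σ| ≤ n−3; {g_2} ∪ θ with θ ⊆ {f_3,…,f_n} and |θ| ≤ n−3; and {g_3} ∪ φ with φ ⊆ {f_4,…,f_n} and |φ| ≤ n−3. Then X is a generating pattern on [2n] with G_X = Δ(n), and for any algebraically closed field k, V_X = {α ∈ k^{2n} : α_{g_1}·α_{g_2}⋯α_{g_n} = 0}, the union of the n coordinate hyperplanes {α_{g_i} = 0}. -/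
open scoped Classical

noncomputable section

/-- A *generating pattern* on `[n]`: a finite set `X` of nonempty subsets of `Fin n`
such that for all `i ≠ j` there is `σ ∈ X` with `i ∈ σ` and `j ∉ σ`. -/
def IsGenPattern (n : ℕ) (X : Finset (Finset (Fin n))) : Prop :=
  (∀ σ ∈ X, σ.Nonempty) ∧ ∀ i j : Fin n, i ≠ j → ∃ σ ∈ X, i ∈ σ ∧ j ∉ σ

/-- Adjacency in the GCD graph of a generating pattern. -/
def GcdAdj {n : ℕ} (X : Finset (Finset (Fin n))) (i j : Fin n) : Prop :=
  i ≠ j ∧ ∃ σ ∈ X, i ∈ σ ∧ j ∈ σ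

/-- The neighborhood of a set of vertices in the GCD graph. -/
def Nbhd {n : ℕ} (X : Finset (Finset (Fin n))) (S : Finset (Fin n)) : Finset (Fin n) :=
  Finset.univ.filter fun j => ∃ i ∈ S, GcdAdj X i j

/-- The differential edge `d_{σ,i}` (from `σ ∪ {i}` to `σ`) exists. -/
def DiffEdge {n : ℕ} (X : Finset (Finset (Fin n))) (σ : Finset (Fin n)) (i : Fin n) : Prop :=
  i ∉ σ ∧ ∀ τ ∈ X, i ∈ τ → (τ ∩ σ).Nonempty

/-- The homotopy edge `h_{σ,i}` (from `σ` to `σ ∪ {i}`) exists. -/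
def HomEdge {n : ℕ} (X : Finset (Finset (Fin n))) (σ : Finset (Fin n)) (i : Fin n) : Prop :=
  i ∉ σ ∧ i ∉ Nbhd X σ

/-- `sign(σ, i) = (-1)^{|{j ∈ σ : j < i}|}`. -/
def edgeSign {n : ℕ} (σ : Finset (Fin n)) (i : Fin n) : ℤ :=
  (-1) ^ (σ.filter fun j => j < i).card

/-- The Taylor matrix of the generating pattern `X`, evaluated at the point `a : Fin n → k`. -/
def taylorMatrixAt {n : ℕ} {k : Type*} [Field k] (X : Finset (Finset (Fin n)))
    (a : Fin n → k) : Matrix (Finset (Fin n)) (Finset (Fin n)) k :=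
  fun r c =>
    (∑ i : Fin n, if c = insert i r ∧ DiffEdge X r i then (edgeSign r i : k) else 0) +
      ∑ i : Fin n, if r = insert i c ∧ HomEdge X c i then (edgeSign c i : k) * a i else 0

/-- The cohomological support variety `V_X ⊆ k^n`: the locus where all
`2^(n-1) × 2^(n-1)` minors of the Taylor matrix vanish. -/
def supportVariety {n : ℕ} (k : Type*) [Field k] (X : Finset (Finset (Fin n))) :
    Set (Fin n → k) :=
  { a | ∀ f g : Fin (2 ^ (n - 1)) → Finset (Fin n),
      Function.Injective f → Function.Injective g →
      ((taylorMatrixAt X a).submatrix f g).det = 0 }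

/-- Vertices of `Δ(n)` are `Fin (2*n)`: values `0,…,n-1` are `f_1,…,f_n` and values
`n,…,2n-1` are `g_1,…,g_n`.  Adjacency: `{f_i, f_j}` for `i ≠ j` and `{f_i, g_j}` for
`i ≠ j`. -/
def DeltaAdj (n : ℕ) (i j : Fin (2 * n)) : Prop :=
  i ≠ j ∧
    ((i.val < n ∧ j.val < n) ∨
      (i.val < n ∧ n ≤ j.val ∧ i.val ≠ j.val - n) ∨
      (j.val < n ∧ n ≤ i.val ∧ j.val ≠ i.val - n))

/-- The cliques of `Δ(n)`: nonempty subsets of `{f_1,…,f_n}`, together with the sets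
`{g_i} ∪ σ` for `σ ⊆ {f_1,…,f_n} ∖ {f_i}`. -/
def DeltaClique (n : ℕ) (s : Finset (Fin (2 * n))) : Prop :=
  s.Nonempty ∧
    ((∀ v ∈ s, v.val < n) ∨
      ∃ g ∈ s, n ≤ g.val ∧ ∀ v ∈ s, v ≠ g → v.val < n ∧ v.val ≠ g.val - n)

/-- The excluded cliques: `{g_t} ∪ σ` with `t ∈ {1,2,3}`, `σ ⊆ {f_{t+1},…,f_n}` and
`|σ| ≤ n - 3` (so the whole set has at most `n - 2` elements). -/
def DeltaExcluded (n : ℕ) (s : Finset (Fin (2 * n))) : Prop :=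
  ∃ t < 3, ∃ g ∈ s, g.val = n + t ∧ s.card ≤ n - 2 ∧
    ∀ v ∈ s, v ≠ g → t + 1 ≤ v.val ∧ v.val < n

/-- The generating pattern consisting of all nonempty cliques of `Δ(n)` except the
excluded ones. -/
def deltaPattern (n : ℕ) : Finset (Finset (Fin (2 * n))) :=
  Finset.univ.filter fun s => DeltaClique n s ∧ ¬ DeltaExcluded n s

lemma aux_exists_rows {m l : Type*} [Fintype m] [Fintype l] {k : Type*} [Field k] (A : Matrix m l k) (M : ℕ)
    (h : M ≤ A.rank) : ∃ f : Fin M → m, LinearIndependent k (A.submatrix f id).row := by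
  rw [Matrix.rank_eq_finrank_span_row] at h
  obtain ⟨f, hf, -, hli⟩ := Submodule.exists_fun_fin_finrank_span_eq k (Set.range A.row)
  choose r hr using hf
  refine ⟨r ∘ Fin.castLE h, ?_⟩
  have := hli.comp (Fin.castLE h) (Fin.castLE_injective h)
  have e : (A.submatrix (r ∘ Fin.castLE h) id).row = f ∘ Fin.castLE h := by
    funext i
    simp only [Function.comp]
    rw [← hr]
    rfl
  rw [e]
  exact this

lemma aux_exists_minor {m : Type*} [Fintype m] {k : Type*} [Field k] (A : Matrix m m k) (M : ℕ)
    (h : M ≤ A.rank) : ∃ f g : Fin M → m, Function.Injective f ∧ Function.Injective g ∧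
      (A.submatrix f g).det ≠ 0 := by
  obtain ⟨f, hf⟩ := aux_exists_rows A M h
  have h2 : M ≤ (A.submatrix f id).transpose.rank := by
    rw [Matrix.rank_transpose, LinearIndependent.rank_matrix hf]; simp
  obtain ⟨g, hg⟩ := aux_exists_rows _ M h2
  have hdet : (A.submatrix f g).det ≠ 0 := by
    have := Matrix.linearIndependent_rows_iff_isUnit.1 hg
    rw [Matrix.isUnit_iff_isUnit_det, isUnit_iff_ne_zero] at this
    rw [← Matrix.det_transpose]
    exact this
  refine ⟨f, g, ?_, ?_, hdet⟩
  · intro x y hxy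
    apply hf.injective
    funext j
    simp [Matrix.row, hxy]
  · intro x y hxy
    apply hg.injective
    funext j
    simp [Matrix.row, hxy]

lemma aux_minor_zero {m : Type*} [Fintype m] {k : Type*} [Field k] (A : Matrix m m k) (M : ℕ)
    (h : A.rank < M) (f g : Fin M → m) : (A.submatrix f g).det = 0 := by
  by_contra hd
  have h1 := Matrix.rank_of_det_ne_zero hd
  have h2 := Matrix.rank_submatrix_le A f g
  simp at h1
  omega

lemma aux_rank_lower {m : Type*} [Fintype m] {k : Type*} [Field k] (A H : Matrix m m k)
    (h : ∀ v : m → k, A.mulVec (H.mulVec v) + H.mulVec (A.mulVec v) = 0 → v = 0) :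
    Fintype.card m ≤ 2 * A.rank := by
  have hu : IsUnit (A * H + H * A) := by
    rw [← Matrix.mulVec_injective_iff_isUnit]
    intro v w hvw
    have := h (v - w) (by
      simp only [Matrix.mulVec_mulVec]
      rw [← Matrix.add_mulVec, Matrix.mulVec_sub]
      exact sub_eq_zero.2 hvw)
    exact sub_eq_zero.1 this
  have h1 := Matrix.rank_of_isUnit _ hu
  have h2 : (A * H + H * A).rank ≤ (A * H).rank + (H * A).rank := by
    unfold Matrix.rank
    rw [Matrix.mulVecLin_add]
    refine le_trans (Submodule.finrank_mono (LinearMap.range_add_le _ _)) ?_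
    exact Submodule.finrank_add_le_finrank_add_finrank _ _
  have h3 := Matrix.rank_mul_le_left A H
  have h4 := Matrix.rank_mul_le_right H A
  omega

lemma aux_rank_upper {m : Type*} [Fintype m] {k : Type*} [Field k] (A : Matrix m m k)
    (h : ∀ v, A.mulVec (A.mulVec v) = 0) (x : m) (hr : ∀ v, A.mulVec v x = 0)
    (hc : A.mulVec (Pi.single x 1) = 0) : 2 * A.rank < Fintype.card m := by
  have h1 := LinearMap.finrank_range_add_finrank_ker A.mulVecLin
  rw [Module.finrank_fintype_fun_eq_card] at h1
  have h2 : LinearMap.range A.mulVecLin < LinearMap.ker A.mulVecLin := by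
    refine lt_of_le_of_ne ?_ ?_
    · rintro _ ⟨v, rfl⟩
      simpa using h v
    · intro he
      have hx : (Pi.single x 1 : m → k) ∈ LinearMap.ker A.mulVecLin := by simpa using hc
      rw [← he] at hx
      obtain ⟨v, hv⟩ := hx
      have := hr v
      rw [Matrix.mulVecLin_apply] at hv
      rw [hv] at this
      simp at this
  have h3 := Submodule.finrank_lt_finrank_of_lt h2
  unfold Matrix.rank
  omega

/-- toggle -/
def tog {N : ℕ} (i : Fin N) (r : Finset (Fin N)) : Finset (Fin N) :=
  if i ∈ r then r.erase i else insert i r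

lemma mem_tog {N : ℕ} (i j : Fin N) (r : Finset (Fin N)) :
    j ∈ tog i r ↔ (if j = i then j ∉ r else j ∈ r) := by
  unfold tog
  by_cases h : j = i
  · subst h; by_cases h2 : j ∈ r <;> simp [h2]
  · by_cases h2 : i ∈ r <;> simp [h, h2]

lemma mem_tog_self {N : ℕ} (i : Fin N) (r : Finset (Fin N)) : i ∈ tog i r ↔ i ∉ r := by
  simp [mem_tog]

lemma mem_tog_ne {N : ℕ} {i j : Fin N} (h : j ≠ i) (r : Finset (Fin N)) : j ∈ tog i r ↔ j ∈ r := by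
  simp [mem_tog, h]

lemma tog_tog {N : ℕ} (i : Fin N) (r : Finset (Fin N)) : tog i (tog i r) = r := by
  ext j; by_cases h : j = i
  · subst h; simp [mem_tog]
  · simp [mem_tog, h]

lemma tog_comm {N : ℕ} (i j : Fin N) (r : Finset (Fin N)) : tog i (tog j r) = tog j (tog i r) := by
  ext l; simp only [mem_tog]; split_ifs <;> simp

/-- sign in k -/
def sg (k : Type*) [Field k] {N : ℕ} (r : Finset (Fin N)) (i : Fin N) : k := (edgeSign r i : k)

lemma sg_sq (k : Type*) [Field k] {N : ℕ} (r : Finset (Fin N)) (i : Fin N) :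
    sg k r i * sg k r i = 1 := by
  unfold sg edgeSign
  rw [← Int.cast_mul, ← mul_pow]; simp

lemma sg_congr (k : Type*) [Field k] {N : ℕ} (r r' : Finset (Fin N)) (i : Fin N)
    (h : ∀ j, j < i → (j ∈ r ↔ j ∈ r')) : sg k r i = sg k r' i := by
  unfold sg edgeSign
  congr 3
  ext j
  simp only [Finset.mem_filter]
  constructor
  · rintro ⟨a, b⟩; exact ⟨(h j b).1 a, b⟩
  · rintro ⟨a, b⟩; exact ⟨(h j b).2 a, b⟩

lemma sg_tog_self (k : Type*) [Field k] {N : ℕ} (r : Finset (Fin N)) (i : Fin N) :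
    sg k (tog i r) i = sg k r i :=
  sg_congr k _ _ _ fun j hj => mem_tog_ne hj.ne r

lemma sg_tog_lt (k : Type*) [Field k] {N : ℕ} (r : Finset (Fin N)) {i j : Fin N} (h : i < j) :
    sg k (tog j r) i = sg k r i :=
  sg_congr k _ _ _ fun l hl => mem_tog_ne (hl.trans h).ne r

lemma sg_insert (k : Type*) [Field k] {N : ℕ} (r : Finset (Fin N)) {i j : Fin N} (h : j < i)
    (hj : j ∉ r) : sg k (insert j r) i = - sg k r i := by
  unfold sg edgeSign
  rw [Finset.filter_insert, if_pos h, Finset.card_insert_of_notMem (by simp [hj]), pow_succ]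
  simp

lemma sg_tog_gt (k : Type*) [Field k] {N : ℕ} (r : Finset (Fin N)) {i j : Fin N} (h : j < i) :
    sg k (tog j r) i = - sg k r i := by
  by_cases hj : j ∈ r
  · have h1 : tog j r = r.erase j := by simp [tog, hj]
    have := sg_insert k (r.erase j) h (by simp)
    rw [Finset.insert_erase hj] at this
    rw [h1, this, neg_neg]
  · have h1 : tog j r = insert j r := by simp [tog, hj]
    rw [h1, sg_insert k r h hj]

lemma sg_anti (k : Type*) [Field k] {N : ℕ} (r : Finset (Fin N)) {i j : Fin N} (h : i ≠ j) :
    sg k r i * sg k (tog i r) j = - (sg k r j * sg k (tog j r) i) := by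
  rcases lt_or_gt_of_ne h with h | h
  · rw [sg_tog_gt k r h, sg_tog_lt k r h]; ring
  · rw [sg_tog_gt k r h, sg_tog_lt k r h]; ring

/-- mask -/
def msk {N : ℕ} {k : Type*} [Field k] (X : Finset (Finset (Fin N))) (a : Fin N → k)
    (i : Fin N) (r : Finset (Fin N)) : k :=
  if i ∈ r then (if HomEdge X (r.erase i) i then a i else 0)
  else (if DiffEdge X r i then 1 else 0)

lemma taylor_mulVec {N : ℕ} {k : Type*} [Field k] (X : Finset (Finset (Fin N))) (a : Fin N → k)
    (v : Finset (Fin N) → k) (r : Finset (Fin N)) :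
    (taylorMatrixAt X a).mulVec v r = ∑ i, sg k r i * msk X a i r * v (tog i r) := by
  unfold Matrix.mulVec dotProduct taylorMatrixAt
  simp only [← Finset.sum_add_distrib, Finset.sum_mul]
  rw [Finset.sum_comm]
  refine Finset.sum_congr rfl fun i _ => ?_
  rw [Finset.sum_eq_single (tog i r)]
  · congr 1
    by_cases hi : i ∈ r
    · have ht : tog i r = r.erase i := by simp [tog, hi]
      have h1 : ¬ DiffEdge X r i := fun h => h.1 hi
      have h2 : sg k (r.erase i) i = sg k r i := by rw [← ht, sg_tog_self]
      have h3 : r = insert i (r.erase i) := (Finset.insert_erase hi).symm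
      rw [ht]
      unfold msk
      rw [if_pos hi]
      unfold sg at *
      simp [h1, ← h3, h2]
    · have ht : tog i r = insert i r := by simp [tog, hi]
      have h1 : ¬ HomEdge X (insert i r) i := fun h => h.1 (by simp)
      rw [ht]
      unfold msk sg
      rw [if_neg hi]
      simp [h1]
  · intro c _ hc
    rw [if_neg, if_neg, add_zero, zero_mul]
    · rintro ⟨h1, h2⟩
      apply hc
      have : i ∈ r := by rw [h1]; simp
      simp only [tog, this, if_true]
      rw [h1, Finset.erase_insert h2.1]
    · rintro ⟨h1, h2⟩
      apply hc
      simp [tog, h2.1, h1]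
  · simp

lemma GcdAdj_comm {N : ℕ} (X : Finset (Finset (Fin N))) (i j : Fin N) :
    GcdAdj X i j → GcdAdj X j i := by
  rintro ⟨h, s, hs, h1, h2⟩; exact ⟨h.symm, s, hs, h2, h1⟩

lemma homEdge_iff {N : ℕ} (X : Finset (Finset (Fin N))) (s : Finset (Fin N)) (i : Fin N) :
    HomEdge X s i ↔ i ∉ s ∧ ∀ j ∈ s, ¬ GcdAdj X j i := by
  simp [HomEdge, Nbhd]

lemma homEdge_iff2 {N : ℕ} (X : Finset (Finset (Fin N))) (s : Finset (Fin N)) (i : Fin N) :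
    HomEdge X s i ↔ i ∉ s ∧ ∀ j ∈ s, ∀ t ∈ X, j ∈ t → i ∈ t → False := by
  rw [homEdge_iff]
  constructor
  · rintro ⟨h1, h2⟩
    exact ⟨h1, fun j hj t ht a b => h2 j hj ⟨fun e => h1 (e ▸ hj), t, ht, a, b⟩⟩
  · rintro ⟨h1, h2⟩
    exact ⟨h1, fun j hj ⟨_, t, ht, a, b⟩ => h2 j hj t ht a b⟩

lemma diffEdge_iff {N : ℕ} (X : Finset (Finset (Fin N))) (s : Finset (Fin N)) (i : Fin N) :
    DiffEdge X s i ↔ i ∉ s ∧ ∀ t ∈ X, i ∈ t → ∃ j ∈ s, j ∈ t := by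
  simp only [DiffEdge, Finset.Nonempty, Finset.mem_inter]
  simp only [and_comm]

lemma msk_diag {N : ℕ} {k : Type*} [Field k] (X : Finset (Finset (Fin N))) (a : Fin N → k)
    (i : Fin N) (r : Finset (Fin N)) (hX : ∃ t ∈ X, i ∈ t) :
    msk X a i r * msk X a i (tog i r) = 0 := by
  obtain ⟨t, ht, hit⟩ := hX
  have key : ∀ s, ¬ (HomEdge X s i ∧ DiffEdge X s i) := by
    rintro s ⟨h1, h2⟩
    rw [homEdge_iff2] at h1
    rw [diffEdge_iff] at h2
    obtain ⟨j, hj, hj2⟩ := h2.2 t ht hit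
    exact h1.2 j hj t ht hj2 hit
  by_cases hi : i ∈ r
  · have h2 : tog i r = r.erase i := by simp [tog, hi]
    have := key (r.erase i)
    simp only [msk, mem_tog_self, hi, if_true, not_true, if_false, h2]
    by_cases hh : HomEdge X (r.erase i) i
    · have : ¬ DiffEdge X (r.erase i) i := fun h => this ⟨hh, h⟩
      simp [this]
    · simp [hh]
  · have h2 : tog i r = insert i r := by simp [tog, hi]
    have := key r
    simp only [msk, mem_tog_self, hi, if_true, not_false_iff, if_false, h2, Finset.mem_insert, true_or, Finset.erase_insert hi]
    by_cases hh : HomEdge X r i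
    · have : ¬ DiffEdge X r i := fun h => this ⟨hh, h⟩
      simp [this]
    · simp [hh]

/-- mask as a proposition -/
def mskP {N : ℕ} (X : Finset (Finset (Fin N))) (i : Fin N) (r : Finset (Fin N)) : Prop :=
  if i ∈ r then ∀ j ∈ r, j ≠ i → ∀ t ∈ X, j ∈ t → i ∈ t → False
  else ∀ t ∈ X, i ∈ t → ∃ j ∈ r, j ∈ t

lemma msk_eq {N : ℕ} {k : Type*} [Field k] (X : Finset (Finset (Fin N))) (a : Fin N → k)
    (i : Fin N) (r : Finset (Fin N)) :
    msk X a i r = if mskP X i r then (if i ∈ r then a i else 1) else 0 := by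
  unfold msk mskP
  by_cases hi : i ∈ r
  · simp only [hi, if_true]
    congr 1
    rw [homEdge_iff2]
    simp only [Finset.mem_erase]
    apply propext
    constructor
    · rintro ⟨_, h⟩ j hj hji; exact h j ⟨hji, hj⟩
    · intro h; exact ⟨by simp, fun j hj => h j hj.2 hj.1⟩
  · simp only [hi, if_false]
    congr 1
    rw [diffEdge_iff]
    simp [hi]

lemma mskP_swap {N : ℕ} (X : Finset (Finset (Fin N)))
    {i j : Fin N} (hij : i ≠ j) (r : Finset (Fin N)) :
    mskP X i r → mskP X j (tog i r) → (mskP X j r ∧ mskP X i (tog j r)) := by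
  unfold mskP
  intro h1 h2
  simp only [mem_tog_ne hij.symm] at h2
  simp only [mem_tog_ne hij]
  have ht := mem_tog_self i r
  have ht' := mem_tog_self j r
  have hn : ∀ l, l ≠ i → (l ∈ tog i r ↔ l ∈ r) := fun l hl => mem_tog_ne hl r
  have hn' : ∀ l, l ≠ j → (l ∈ tog j r ↔ l ∈ r) := fun l hl => mem_tog_ne hl r
  by_cases hi : i ∈ r <;> by_cases hj : j ∈ r <;> simp only [hi, hj, if_true, if_false] at h1 h2 ⊢
  · grind
  · grind
  · grind
  · grind

lemma msk_swap {N : ℕ} {k : Type*} [Field k] (X : Finset (Finset (Fin N))) (a : Fin N → k)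
    {i j : Fin N} (hij : i ≠ j) (r : Finset (Fin N)) :
    msk X a i r * msk X a j (tog i r) = msk X a j r * msk X a i (tog j r) := by
  simp only [msk_eq, mem_tog_ne hij, mem_tog_ne hij.symm]
  have h1 := mskP_swap X hij r
  have h2 := mskP_swap X hij.symm r
  by_cases h : mskP X i r ∧ mskP X j (tog i r)
  · obtain ⟨h3, h4⟩ := h1 h.1 h.2
    simp only [h.1, h.2, h3, h4, if_true]
    ring
  · have h' : ¬ (mskP X j r ∧ mskP X i (tog j r)) := fun h' => h (h2 h'.1 h'.2)
    rw [not_and_or] at h h'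
    rcases h with h | h <;> rcases h' with h' | h' <;> simp [h, h']

lemma taylor_sq {N : ℕ} {k : Type*} [Field k] (X : Finset (Finset (Fin N))) (a : Fin N → k)
    (hX : ∀ i, ∃ t ∈ X, i ∈ t) (v : Finset (Fin N) → k) :
    (taylorMatrixAt X a).mulVec ((taylorMatrixAt X a).mulVec v) = 0 := by
  funext r
  rw [taylor_mulVec]
  simp only [taylor_mulVec, Finset.mul_sum]
  rw [← Finset.sum_product']
  refine Finset.sum_involution (fun p _ => (p.2, p.1)) ?_ ?_ (by simp) (by simp)
  · rintro ⟨i, j⟩ -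
    by_cases hij : i = j
    · subst hij
      have := msk_diag X a i r (hX i)
      have h2 : ∀ x y z : k, x * msk X a i r * (y * msk X a i (tog i r) * z) = 0 := by
        intro x y z
        linear_combination x * y * z * this
      simp [h2]
    · simp only
      rw [tog_comm j i]
      linear_combination (msk X a i r * msk X a j (tog i r) * v (tog i (tog j r))) * sg_anti k r hij - (sg k r j * sg k (tog j r) i * v (tog i (tog j r))) * msk_swap X a hij r
  · rintro ⟨i, j⟩ - hne heq
    apply hne
    simp only [Prod.mk.injEq] at heq
    obtain ⟨h, -⟩ := heq
    subst h
    have := msk_diag X a j r (hX j)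
    linear_combination (sg k r j) * (sg k (tog j r) j) * v (tog j (tog j r)) * this

lemma taylor_exact {N : ℕ} {k : Type*} [Field k] (X : Finset (Finset (Fin N))) (a : Fin N → k)
    (F : Fin N → Prop) (L : Finset (Fin N) → Fin N) (p q : Finset (Fin N) → k)
    (hF : ∀ i, F i → ∀ r, msk X a i r ≠ 0 → i ∈ r ∧ ∀ j ∈ r, F j → j = i)
    (hG : ∀ i l, ¬ F i → ¬ F l → i ≠ l → ∀ r, msk X a i (tog l r) = msk X a i r)
    (hL : ∀ r i, ¬ F i → L (tog i r) = L r)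
    (hp : ∀ r i, ¬ F i → p (tog i r) = p r)
    (hq : ∀ r i, ¬ F i → q (tog i r) = q r)
    (hLF : ∀ r, ¬ F (L r))
    (h1 : ∀ r, L r ∈ r → p r * msk X a (L r) (tog (L r) r) + q r * msk X a (L r) r = 1) :
    2 ^ N ≤ 2 * (taylorMatrixAt X a).rank := by
  set u : Finset (Fin N) → k := fun r => if L r ∈ r then p r else q r with hu
  set H : Matrix (Finset (Fin N)) (Finset (Fin N)) k :=
    fun r c => if c = tog (L r) r then sg k r (L r) * u r else 0 with hH
  have hHv : ∀ v r, H.mulVec v r = sg k r (L r) * u r * v (tog (L r) r) := by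
    intro v r
    simp [hH, Matrix.mulVec, dotProduct]
  have huself : ∀ r, msk X a (L r) r * u (tog (L r) r) + u r * msk X a (L r) (tog (L r) r) = 1 := by
    intro r
    have e1 := hL r _ (hLF r)
    have e2 := hp r _ (hLF r)
    have e3 := hq r _ (hLF r)
    by_cases hr : L r ∈ r
    · have := h1 r hr
      simp only [hu, e1, e2, e3, mem_tog_self, hr, not_true, if_false, if_true]
      linear_combination this
    · have := h1 (tog (L r) r) (by rw [e1, mem_tog_self]; exact hr)
      rw [e1, e2, e3, tog_tog] at this
      simp only [hu, e1, e2, e3, mem_tog_self, hr, not_false_iff, if_false, if_true]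
      linear_combination this
  have hune : ∀ r i, ¬ F i → i ≠ L r → u (tog i r) = u r := by
    intro r i hi hne
    simp only [hu, hL r i hi, hp r i hi, hq r i hi, mem_tog_ne hne.symm]
  have key : ∀ (v : Finset (Fin N) → k) r,
      (∀ i, F i → msk X a i r * v (tog (L (tog i r)) (tog i r)) = 0 ∧
        msk X a i (tog (L r) r) * v (tog i (tog (L r) r)) = 0) →
      ((taylorMatrixAt X a).mulVec (H.mulVec v) + H.mulVec ((taylorMatrixAt X a).mulVec v)) r
        = v r := by
    intro v r hf
    rw [Pi.add_apply, taylor_mulVec, hHv, taylor_mulVec, Finset.mul_sum, ← Finset.sum_add_distrib]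
    simp only [hHv]
    rw [Finset.sum_eq_single (L r)]
    · rw [hL r _ (hLF r), tog_tog, sg_tog_self]
      have e1 := huself r
      have e2 := sg_sq k r (L r)
      linear_combination v r * e2 * (msk X a (L r) r * u (tog (L r) r) + u r * msk X a (L r) (tog (L r) r)) + v r * e1
    · intro i _ hne
      by_cases hi : F i
      · obtain ⟨e1, e2⟩ := hf i hi
        linear_combination sg k r i * sg k (tog i r) (L (tog i r)) * u (tog i r) * e1 + sg k r (L r) * u r * sg k (tog (L r) r) i * e2
      · rw [hL r i hi, hune r i hi hne, hG i (L r) hi (hLF r) hne r, tog_comm i (L r)]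
        have := sg_anti k r hne
        linear_combination msk X a i r * u r * v (tog (L r) (tog i r)) * this
    · simp
  have := aux_rank_lower (taylorMatrixAt X a) H ?_
  · simpa using this
  intro v hv
  have s1 : ∀ r : Finset (Fin N), (∀ j ∈ r, ¬ F j) → v r = 0 := by
    intro r hr
    rw [← key v r, hv]; · rfl
    intro i hi
    constructor
    · by_cases hm : msk X a i r = 0
      · simp [hm]
      · exact absurd hi (hr i (hF i hi r hm).1)
    · by_cases hm : msk X a i (tog (L r) r) = 0
      · simp [hm]
      · have := (hF i hi _ hm).1
        rw [mem_tog_ne (show i ≠ L r from fun e => hLF r (e ▸ hi))] at this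
        exact absurd hi (hr i this)
  funext r
  rw [← key v r, hv]
  intro i hi
  constructor
  · by_cases hm : msk X a i r = 0
    · simp [hm]
    · rw [s1, mul_zero]
      intro j hj hFj
      rw [mem_tog_ne (fun e => hLF _ (e ▸ hFj))] at hj
      obtain ⟨h3, h4⟩ := hF i hi r hm
      by_cases hji : j = i
      · subst hji; rw [mem_tog_self] at hj; exact hj h3
      · rw [mem_tog_ne hji] at hj; exact hji (h4 j hj hFj)
  · by_cases hm : msk X a i (tog (L r) r) = 0
    · simp [hm]
    · rw [s1, mul_zero]
      intro j hj hFj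
      obtain ⟨h3, h4⟩ := hF i hi _ hm
      by_cases hji : j = i
      · subst hji; rw [mem_tog_self] at hj; exact hj h3
      · rw [mem_tog_ne hji] at hj; exact hji (h4 j hj hFj)

lemma mem_dp {n : ℕ} {s : Finset (Fin (2 * n))} :
    s ∈ deltaPattern n ↔ DeltaClique n s ∧ ¬ DeltaExcluded n s := by
  simp [deltaPattern]

lemma dp_f {n : ℕ} {s : Finset (Fin (2 * n))} (h : s.Nonempty) (hs : ∀ v ∈ s, v.val < n) :
    s ∈ deltaPattern n := by
  rw [mem_dp]
  refine ⟨⟨h, Or.inl hs⟩, ?_⟩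
  rintro ⟨t, ht, g, hg, hgv, -⟩
  have := hs g hg
  omega

lemma dp_g {n : ℕ} (hn : 3 ≤ n) (g j : Fin (2 * n)) (hg : n ≤ g.val) (hj : g ≠ j) :
    ∃ s ∈ deltaPattern n, g ∈ s ∧ j ∉ s ∧ ∀ v : Fin (2 * n), v.val < n → v.val ≠ g.val - n → v ≠ j → v ∈ s := by
  have hgl := g.isLt
  set g' : Fin (2 * n) := ⟨g.val - n, by omega⟩ with hg'
  set S : Finset (Fin (2 * n)) := insert g (((Finset.univ.filter fun v : Fin (2 * n) => v.val < n).erase g').erase j) with hS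
  have hcard : n - 1 ≤ S.card := by
    rw [hS, Finset.card_insert_of_notMem (by simp; omega)]
    have h1 : (Finset.univ.filter fun v : Fin (2 * n) => v.val < n).card = n := by
      rw [Fin.card_filter_val_lt]; omega
    have h2 := Finset.pred_card_le_card_erase (s := Finset.univ.filter fun v : Fin (2 * n) => v.val < n) (a := g')
    have h3 := Finset.pred_card_le_card_erase (s := (Finset.univ.filter fun v : Fin (2 * n) => v.val < n).erase g') (a := j)
    omega
  refine ⟨S, ?_, by simp [hS], by simp [hS, hj.symm], ?_⟩
  · rw [mem_dp]
    refine ⟨⟨⟨g, by simp [hS]⟩, Or.inr ⟨g, by simp [hS], hg, ?_⟩⟩, ?_⟩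
    · intro v hv hvg
      simp only [hS, Finset.mem_insert, hvg, false_or, Finset.mem_erase, Finset.mem_filter, hg', ne_eq, Fin.ext_iff] at hv
      exact ⟨hv.2.2.2, hv.2.1⟩
    · rintro ⟨t, ht, w, hw, hwv, hc, -⟩
      omega
  · intro v h1 h2 h3
    simp only [hS, Finset.mem_insert, Finset.mem_erase, Finset.mem_filter, hg', ne_eq, Fin.ext_iff]
    right
    exact ⟨fun e => h3 (Fin.ext e), h2, Finset.mem_univ _, h1⟩

lemma dp_g_mem {n : ℕ} {s : Finset (Fin (2 * n))} (hs : s ∈ deltaPattern n) {g v : Fin (2 * n)} (hg : g ∈ s)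
    (hgn : n ≤ g.val) (hv : v ∈ s) (hvg : v ≠ g) : v.val < n ∧ v.val ≠ g.val - n := by
  rw [mem_dp] at hs
  obtain ⟨⟨-, h | ⟨w, hw, hwn, h⟩⟩, -⟩ := hs
  · have := h g hg; omega
  · by_cases hgw : g = w
    · subst hgw; exact h v hv hvg
    · have := h g hg hgw; omega

lemma dp_gen {n : ℕ} (hn : 3 ≤ n) : IsGenPattern (2 * n) (deltaPattern n) := by
  constructor
  · intro s hs; rw [mem_dp] at hs; exact hs.1.1
  · intro i j hij
    by_cases hi : i.val < n
    · exact ⟨{i}, dp_f (by simp) (by simpa using hi), by simp, by simpa using hij.symm⟩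
    · obtain ⟨s, h1, h2, h3, -⟩ := dp_g hn i j (by omega) hij
      exact ⟨s, h1, h2, h3⟩

lemma dp_adj_fg {n : ℕ} (hn : 3 ≤ n) {i j : Fin (2 * n)} (hi : i.val < n) (hj : n ≤ j.val)
    (h : i.val ≠ j.val - n) : GcdAdj (deltaPattern n) i j := by
  have hjl := j.isLt
  obtain ⟨s, h1, h2, h3, h4⟩ := dp_g hn j ⟨j.val - n, by omega⟩ hj (by simp [Fin.ext_iff]; omega)
  refine ⟨fun e => ?_, s, h1, h4 i hi h ?_, h2⟩
  · subst e; omega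
  · intro e; apply h; rw [e]

lemma dp_adj {n : ℕ} (hn : 3 ≤ n) (i j : Fin (2 * n)) :
    GcdAdj (deltaPattern n) i j ↔ DeltaAdj n i j := by
  constructor
  · rintro ⟨hij, s, hs, hi, hj⟩
    refine ⟨hij, ?_⟩
    by_cases h1 : i.val < n
    · by_cases h2 : j.val < n
      · exact Or.inl ⟨h1, h2⟩
      · have := dp_g_mem hs hj (by omega) hi hij
        exact Or.inr (Or.inl ⟨h1, by omega, this.2⟩)
    · have := dp_g_mem hs hi (by omega) hj hij.symm
      exact Or.inr (Or.inr ⟨this.1, by omega, this.2⟩)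
  · rintro ⟨hij, ⟨h1, h2⟩ | ⟨h1, h2, h3⟩ | ⟨h1, h2, h3⟩⟩
    · refine ⟨hij, {i, j}, dp_f (by simp) ?_, by simp, by simp⟩
      intro v hv
      simp only [Finset.mem_insert, Finset.mem_singleton] at hv
      rcases hv with rfl | rfl <;> assumption
    · exact dp_adj_fg hn h1 h2 h3
    · exact GcdAdj_comm _ _ _ (dp_adj_fg hn h1 h2 h3)

lemma dp_diff {n t : ℕ} (ht : t < 3) (g b c : Fin (2 * n)) (hg : g.val = n + t)
    (hb : b.val < n) (hc : c.val < n) (htn : t < n)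
    (hbc : b ≠ c) (hbt : b.val ≠ t) (hct : c.val ≠ t)
    (hlt : ∀ x : Fin (2 * n), x.val < t → x = b ∨ x = c)
    (s : Finset (Fin (2 * n))) (hs : s ∈ deltaPattern n) (hgs : g ∈ s) : b ∈ s ∨ c ∈ s := by
  by_contra hcon
  push Not at hcon
  have hmem := fun v (hv : v ∈ s) (hvg : v ≠ g) => dp_g_mem hs hgs (by omega) hv hvg
  rw [mem_dp] at hs
  apply hs.2
  refine ⟨t, ht, g, hgs, hg, ?_, ?_⟩
  · set f : Fin (2 * n) := ⟨t, by omega⟩ with hf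
    have hsub : s.erase g ⊆ (((Finset.univ.filter fun v : Fin (2 * n) => v.val < n).erase f).erase b).erase c := by
      intro v hv
      rw [Finset.mem_erase] at hv
      have h1 := hmem v hv.2 hv.1
      simp only [Finset.mem_erase, Finset.mem_filter, Finset.mem_univ, true_and]
      refine ⟨?_, ?_, ?_, h1.1⟩
      · rintro rfl; exact hcon.2 hv.2
      · rintro rfl; exact hcon.1 hv.2
      · rintro rfl; apply h1.2; simp [hf]; omega
    have hle := Finset.card_le_card hsub
    have h1 : (Finset.univ.filter fun v : Fin (2 * n) => v.val < n).card = n := by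
      rw [Fin.card_filter_val_lt]; omega
    have hbf : b ≠ f := fun e => hbt (by rw [e])
    have hcf : c ≠ f := fun e => hct (by rw [e])
    have e1 : c ∈ ((Finset.univ.filter fun v : Fin (2 * n) => v.val < n).erase f).erase b := by
      simp only [Finset.mem_erase, Finset.mem_filter, Finset.mem_univ, true_and]
      exact ⟨hbc.symm, hcf, hc⟩
    have e2 : b ∈ (Finset.univ.filter fun v : Fin (2 * n) => v.val < n).erase f := by
      simp only [Finset.mem_erase, Finset.mem_filter, Finset.mem_univ, true_and]
      exact ⟨hbf, hb⟩
    have e3 : f ∈ Finset.univ.filter fun v : Fin (2 * n) => v.val < n := by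
      simp only [Finset.mem_filter, Finset.mem_univ, true_and]
      exact htn
    rw [Finset.card_erase_of_mem e1, Finset.card_erase_of_mem e2, Finset.card_erase_of_mem e3,
      Finset.card_erase_of_mem hgs, h1] at hle
    have : b.val < n ∧ c.val < n ∧ b.val ≠ c.val := ⟨hb, hc, fun e => hbc (Fin.ext e)⟩
    omega
  · intro v hv hvg
    have h1 := hmem v hv hvg
    refine ⟨?_, h1.1⟩
    by_contra hlt'
    have h2 : v.val ≠ t := by have := h1.2; omega
    rcases hlt v (by omega) with rfl | rfl
    · exact hcon.1 hv
    · exact hcon.2 hv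

lemma dp_choice {n : ℕ} (hn : 3 ≤ n) (S : Finset (Fin (2 * n))) : ∃ l : Fin (2 * n), n ≤ l.val ∧
    ((∀ t ∈ deltaPattern n, l ∈ t → ∃ j ∈ S, j.val < n ∧ j ∈ t) ∨
     ∀ j ∈ S, j.val < n → j.val = l.val - n) := by
  by_cases h : ∃ b ∈ S, ∃ c ∈ S, b.val < c.val ∧ c.val < n
  · obtain ⟨b, hb, c, hc, hbc, hcn⟩ := h
    have main : ∀ t : ℕ, t < 3 → b.val ≠ t → c.val ≠ t → (∀ x : ℕ, x < t → x = b.val ∨ x = c.val) → ∃ l : Fin (2 * n), n ≤ l.val ∧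
        ((∀ t ∈ deltaPattern n, l ∈ t → ∃ j ∈ S, j.val < n ∧ j ∈ t) ∨
        ∀ j ∈ S, j.val < n → j.val = l.val - n) := by
      intro t ht h1 h2 h3
      refine ⟨⟨n + t, by omega⟩, by simp, Or.inl ?_⟩
      intro s hs hgs
      rcases dp_diff ht ⟨n + t, by omega⟩ b c rfl (by omega) hcn (by omega) (fun e => by subst e; omega) h1 h2
        (fun x hx => by simpa [Fin.ext_iff] using h3 x.val hx) s hs hgs with h | h
      · exact ⟨b, hb, by omega, h⟩
      · exact ⟨c, hc, by omega, h⟩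
    by_cases h0 : b.val = 0
    · by_cases h1 : c.val = 1
      · exact main 2 (by omega) (by omega) (by omega) (by omega)
      · exact main 1 (by omega) (by omega) (by omega) (by omega)
    · exact main 0 (by omega) (by omega) (by omega) (by omega)
  · push Not at h
    by_cases h2 : ∃ b ∈ S, b.val < n
    · obtain ⟨b, hb, hbn⟩ := h2
      refine ⟨⟨n + b.val, by omega⟩, by simp, Or.inr ?_⟩
      intro j hj hjn
      have h3 := h b hb j hj
      have h4 := h j hj b hb
      simp only
      omega
    · push Not at h2
      refine ⟨⟨n, by omega⟩, by simp, Or.inr ?_⟩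
      intro j hj hjn
      have := h2 j hj
      omega

lemma dp_mskP_congr {n : ℕ} {i : Fin (2 * n)} (hi : n ≤ i.val) (r r' : Finset (Fin (2 * n)))
    (h : ∀ j : Fin (2 * n), j.val < n → (j ∈ r ↔ j ∈ r')) (hir : i ∈ r ↔ i ∈ r') :
    mskP (deltaPattern n) i r → mskP (deltaPattern n) i r' := by
  unfold mskP
  by_cases hh : i ∈ r
  · simp only [hh, ← hir, if_true]
    intro H j hj hji t ht hjt hit
    have := dp_g_mem ht hit hi hjt hji
    exact H j ((h j this.1).2 hj) hji t ht hjt hit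
  · simp only [hh, ← hir, if_false]
    intro H t ht hit
    obtain ⟨j, hj, hjt⟩ := H t ht hit
    have := dp_g_mem ht hit hi hjt (fun e => hh (e ▸ hj))
    exact ⟨j, (h j this.1).1 hj, hjt⟩

lemma dp_lower {n : ℕ} (hn : 3 ≤ n) {k : Type*} [Field k] (a : Fin (2 * n) → k)
    (ha : ∀ i : Fin (2 * n), n ≤ i.val → a i ≠ 0) :
    2 ^ (2 * n) ≤ 2 * (taylorMatrixAt (deltaPattern n) a).rank := by
  choose L0 hL0 hL1 using dp_choice hn
  set fl : Finset (Fin (2 * n)) → Finset (Fin (2 * n)) := fun r => r.filter (fun v => v.val < n) with hfl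
  have hflt : ∀ r i, ¬ (i : Fin (2 * n)).val < n → fl (tog i r) = fl r := by
    intro r i hi
    ext j
    simp only [hfl, Finset.mem_filter, mem_tog]
    by_cases hji : j = i
    · subst hji; simp [hi]
    · simp [hji]
  set P : Finset (Fin (2 * n)) → Prop := fun S =>
    ∀ t ∈ deltaPattern n, L0 S ∈ t → ∃ j ∈ S, j.val < n ∧ j ∈ t with hP
  refine taylor_exact (deltaPattern n) a (fun i => i.val < n) (fun r => L0 (fl r))
    (fun r => if P (fl r) then 1 else 0) (fun r => if P (fl r) then 0 else (a (L0 (fl r)))⁻¹)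
    ?_ ?_ ?_ ?_ ?_ ?_ ?_
  · intro i hi r hm
    rw [msk_eq] at hm
    have hm : mskP (deltaPattern n) i r := by
      by_contra h; simp [h] at hm
    unfold mskP at hm
    by_cases hir : i ∈ r
    · refine ⟨hir, ?_⟩
      simp only [hir, if_true] at hm
      intro j hj hjn
      by_contra hji
      obtain ⟨-, t, ht, h1, h2⟩ := (dp_adj hn j i).2 ⟨hji, Or.inl ⟨hjn, hi⟩⟩
      exact hm j hj hji t ht h1 h2
    · simp only [hir, if_false] at hm
      obtain ⟨j, hj, hj2⟩ := hm {i} (dp_f (by simp) (by simpa using hi)) (by simp)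
      simp only [Finset.mem_singleton] at hj2
      exact absurd (hj2 ▸ hj) hir
  · intro i l hi hl hil r
    have h1 : i ∈ tog l r ↔ i ∈ r := mem_tog_ne hil r
    have h2 : ∀ j : Fin (2 * n), j.val < n → (j ∈ tog l r ↔ j ∈ r) :=
      fun j hj => mem_tog_ne (show j ≠ l from fun e => hl (e ▸ hj)) r
    have h3 : mskP (deltaPattern n) i (tog l r) ↔ mskP (deltaPattern n) i r :=
      ⟨dp_mskP_congr (by omega) _ _ h2 h1,
        dp_mskP_congr (by omega) _ _ (fun j hj => (h2 j hj).symm) h1.symm⟩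
    simp only [msk_eq, h1, h3]
  · intro r i hi; simp only [hflt r i hi]
  · intro r i hi; simp only [hflt r i hi]
  · intro r i hi; simp only [hflt r i hi]
  · intro r; have := hL0 (fl r); omega
  · intro r hr
    have hl := hL0 (fl r)
    by_cases hp : P (fl r)
    · have : mskP (deltaPattern n) (L0 (fl r)) (tog (L0 (fl r)) r) := by
        have h0 : L0 (fl r) ∉ tog (L0 (fl r)) r := by rw [mem_tog_self]; simpa using hr
        unfold mskP
        simp only [h0, if_false]
        intro t ht hlt
        obtain ⟨j, hj, hjn, hjt⟩ := hp t ht hlt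
        refine ⟨j, ?_, hjt⟩
        rw [mem_tog_ne (fun e => by rw [e] at hjn; omega)]
        exact (Finset.mem_filter.1 hj).1
      simp only [hp, if_true, msk_eq, this, mem_tog_self, hr, not_true, if_false]
      simp
    · have h2 := (hL1 (fl r)).resolve_left hp
      have : mskP (deltaPattern n) (L0 (fl r)) r := by
        unfold mskP
        simp only [hr, if_true]
        intro j hj hjl t ht hjt hlt
        have h3 := dp_g_mem ht hlt hl hjt hjl
        exact h3.2 (h2 j (Finset.mem_filter.2 ⟨hj, h3.1⟩) h3.1)
      simp only [hp, if_false, msk_eq, this, hr, if_true]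
      simp [ha _ hl]

lemma dp_upper {n : ℕ} (hn : 3 ≤ n) {k : Type*} [Field k] (a : Fin (2 * n) → k)
    (g : Fin (2 * n)) (hg : n ≤ g.val) (ha : a g = 0) :
    2 * (taylorMatrixAt (deltaPattern n) a).rank < 2 ^ (2 * n) := by
  have hgl := g.isLt
  obtain ⟨f, hf⟩ : ∃ f : Fin (2 * n), f.val = g.val - n := ⟨⟨g.val - n, by omega⟩, rfl⟩
  obtain ⟨l, hl, hlg⟩ : ∃ l : Fin (2 * n), n ≤ l.val ∧ l ≠ g := by
    by_cases h : g.val = n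
    · exact ⟨⟨n + 1, by omega⟩, by simp, by simp [Fin.ext_iff]; omega⟩
    · exact ⟨⟨n, by omega⟩, by simp, by simp [Fin.ext_iff]; omega⟩
  have hfn : f.val < n := by omega
  have hlgv : l.val ≠ g.val := fun e => hlg (Fin.ext e)
  have hfl : f ≠ l := fun e => by rw [e] at hfn; omega
  have hgen := dp_gen hn
  have hadj := dp_adj hn
  have hfladj : GcdAdj (deltaPattern n) f l := dp_adj_fg hn hfn hl (by omega)
  obtain ⟨-, t0, ht0, hft0, hlt0⟩ := hfladj
  -- differential edges into subsets of {f, l} do not exist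
  have hD : ∀ (i : Fin (2 * n)) (r : Finset (Fin (2 * n))), i ∉ r → (∀ j ∈ r, j = f ∨ j = l) →
      ¬ mskP (deltaPattern n) i r := by
    intro i r hir hr hm
    unfold mskP at hm
    simp only [hir, if_false] at hm
    by_cases hi : i.val < n
    · obtain ⟨j, hj, hj2⟩ := hm {i} (dp_f (by simp) (by simpa using hi)) (by simp)
      simp only [Finset.mem_singleton] at hj2
      exact hir (hj2 ▸ hj)
    · obtain ⟨t, ht, h1, h2⟩ := hgen.2 i f (fun e => hi (e ▸ hfn))
      obtain ⟨j, hj, hjt⟩ := hm t ht h1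
      rcases hr j hj with rfl | rfl
      · exact h2 hjt
      · have := dp_g_mem ht h1 (by omega) hjt (fun e => hir (e ▸ hj))
        omega
  have hx : ∀ j, j ∈ ({f, l} : Finset (Fin (2 * n))) ↔ j = f ∨ j = l := by simp
  have hrow : ∀ i, msk (deltaPattern n) a i {f, l} = 0 := by
    intro i
    rw [msk_eq, if_neg]
    by_cases hi : i ∈ ({f, l} : Finset (Fin (2 * n)))
    · intro hm
      unfold mskP at hm
      simp only [hi, if_true] at hm
      rcases (hx i).1 hi with rfl | rfl
      · exact hm l (by simp) hfl.symm t0 ht0 hlt0 hft0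
      · exact hm f (by simp) hfl t0 ht0 hft0 hlt0
    · exact hD i _ hi (fun j hj => (hx j).1 hj)
  have hcol : ∀ i, msk (deltaPattern n) a i (tog i {f, l}) = 0 := by
    intro i
    by_cases hi : i ∈ ({f, l} : Finset (Fin (2 * n)))
    · rw [msk_eq, if_neg]
      refine hD i _ (by rw [mem_tog_self]; exact not_not.2 hi) ?_
      intro j hj
      by_cases hji : j = i
      · subst hji; exact (hx j).1 hi
      · rw [mem_tog_ne hji] at hj; exact (hx j).1 hj
    · have hi' : i ∈ tog i ({f, l} : Finset (Fin (2 * n))) := by rw [mem_tog_self]; exact hi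
      have hif : i ≠ f := fun e => hi ((hx i).2 (Or.inl e))
      by_cases hig : i = g
      · subst hig
        rw [msk_eq]; simp [hi', ha]
      · rw [msk_eq, if_neg]
        intro hm
        unfold mskP at hm
        simp only [hi', if_true] at hm
        have : GcdAdj (deltaPattern n) f i := by
          rw [hadj]
          refine ⟨hif.symm, ?_⟩
          have : i.val ≠ g.val := fun e => hig (Fin.ext e)
          omega
        obtain ⟨-, t, ht, h1, h2⟩ := this
        exact hm f (by rw [mem_tog_ne hif.symm]; simp) hif.symm t ht h1 h2
  have := aux_rank_upper (taylorMatrixAt (deltaPattern n) a) (taylor_sq _ a ?_) {f, l} ?_ ?_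
  · simpa using this
  · intro i
    by_cases hi : i = f
    · exact ⟨t0, ht0, hi ▸ hft0⟩
    · obtain ⟨t, ht, h1, -⟩ := hgen.2 i f hi
      exact ⟨t, ht, h1⟩
  · intro v
    rw [taylor_mulVec]
    simp [hrow]
  · funext r
    rw [taylor_mulVec]
    refine Finset.sum_eq_zero fun i _ => ?_
    by_cases h : tog i r = {f, l}
    · have : r = tog i {f, l} := by rw [← h, tog_tog]
      rw [this, hcol]; simp
    · simp [Pi.single_apply, h]

theorem delta_pattern_support (n : ℕ) (hn : 3 ≤ n) (k : Type*) [Field k] [IsAlgClosed k] :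
    IsGenPattern (2 * n) (deltaPattern n) ∧
    (∀ i j : Fin (2 * n), GcdAdj (deltaPattern n) i j ↔ DeltaAdj n i j) ∧
    supportVariety k (deltaPattern n) =
      {α : Fin (2 * n) → k |
        (∏ i ∈ Finset.univ.filter fun i : Fin (2 * n) => n ≤ i.val, α i) = 0} := by
  refine ⟨dp_gen hn, dp_adj hn, ?_⟩
  have hpow : 2 ^ (2 * n) = 2 * 2 ^ (2 * n - 1) := by
    rw [← pow_succ']; congr 1; omega
  ext a
  simp only [supportVariety, Set.mem_setOf_eq, Finset.prod_eq_zero_iff, Finset.mem_filter,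
    Finset.mem_univ, true_and]
  constructor
  · intro h
    by_contra hcon
    push Not at hcon
    have h1 := dp_lower hn a hcon
    obtain ⟨f, g, hf, hg, hd⟩ := aux_exists_minor (taylorMatrixAt (deltaPattern n) a)
      (2 ^ (2 * n - 1)) (by omega)
    exact hd (h f g hf hg)
  · rintro ⟨g, hg, ha⟩ f f' - -
    have h1 := dp_upper hn a g hg ha
    exact aux_minor_zero _ _ (by omega) f f'
end
end

section
/- Let G be a triangle-free simple graph on [n] in which every vertex has degree at least 1, and let ℓ be the number of vertices of G of degree exactly 1. Then the number of generating patterns X on [n] with G_X = G is exactly 2^{n−ℓ}. -/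
open scoped Classical

noncomputable section

def patF {n : ℕ} (G : SimpleGraph (Fin n)) (L S : Finset (Fin n)) :
    Finset (Finset (Fin n)) :=
  Finset.univ.filter fun σ =>
    (∃ i j, G.Adj i j ∧ σ = {i, j}) ∨ (∃ i, (i ∈ L ∨ i ∈ S) ∧ σ = {i})

lemma singleton_mem_patF {n : ℕ} (G : SimpleGraph (Fin n)) (L S : Finset (Fin n)) (i : Fin n) :
    ({i} : Finset (Fin n)) ∈ patF G L S ↔ i ∈ L ∨ i ∈ S := by
  simp only [patF, Finset.mem_filter, Finset.mem_univ, true_and]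
  constructor
  · rintro (⟨a, b, hab, h⟩ | ⟨a, ha, h⟩)
    · have h1 : a ∈ ({i} : Finset (Fin n)) := by rw [h]; simp
      have h2 : b ∈ ({i} : Finset (Fin n)) := by rw [h]; simp
      simp only [Finset.mem_singleton] at h1 h2
      exact absurd (h1.trans h2.symm) hab.ne
    · rw [Finset.singleton_inj] at h
      rwa [h]
  · intro h
    exact Or.inr ⟨i, h, rfl⟩

lemma pair_mem_patF {n : ℕ} (G : SimpleGraph (Fin n)) (L S : Finset (Fin n)) {i j : Fin n}
    (h : G.Adj i j) : ({i, j} : Finset (Fin n)) ∈ patF G L S := by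
  simp only [patF, Finset.mem_filter, Finset.mem_univ, true_and]
  exact Or.inl ⟨i, j, h, rfl⟩

lemma patF_valid {n : ℕ} (G : SimpleGraph (Fin n)) [DecidableRel G.Adj]
    (hdeg : ∀ v, 1 ≤ G.degree v) (L S : Finset (Fin n))
    (hL : ∀ v, v ∈ L ↔ G.degree v = 1) :
    IsGenPattern n (patF G L S) ∧ ∀ i j : Fin n, GcdAdj (patF G L S) i j ↔ G.Adj i j := by
  refine ⟨⟨?_, ?_⟩, ?_⟩
  · intro σ hσ
    simp only [patF, Finset.mem_filter, Finset.mem_univ, true_and] at hσ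
    rcases hσ with ⟨a, b, -, rfl⟩ | ⟨a, -, rfl⟩ <;> simp
  · intro i j hij
    by_cases h1 : G.degree i = 1
    · exact ⟨{i}, (singleton_mem_patF G L S i).2 (Or.inl ((hL i).2 h1)), by simp,
        by simpa using hij.symm⟩
    · have h2 : 1 < (G.neighborFinset i).card := by
        have := hdeg i
        rw [G.card_neighborFinset_eq_degree]; omega
      obtain ⟨k, hk, hkj⟩ := Finset.exists_mem_ne h2 j
      rw [SimpleGraph.mem_neighborFinset] at hk
      refine ⟨{i, k}, pair_mem_patF G L S hk, by simp, ?_⟩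
      simp only [Finset.mem_insert, Finset.mem_singleton, not_or]
      exact ⟨hij.symm, hkj.symm⟩
  · intro i j
    constructor
    · rintro ⟨hij, σ, hσ, hi, hj⟩
      simp only [patF, Finset.mem_filter, Finset.mem_univ, true_and] at hσ
      rcases hσ with ⟨a, b, hab, rfl⟩ | ⟨a, -, rfl⟩
      · simp only [Finset.mem_insert, Finset.mem_singleton] at hi hj
        have := hab.symm
        rcases hi with rfl | rfl <;> rcases hj with rfl | rfl <;> first | assumption | exact absurd rfl hij
      · simp only [Finset.mem_singleton] at hi hj
        exact absurd (hi.trans hj.symm) hij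
    · intro h
      exact ⟨h.ne, {i, j}, pair_mem_patF G L S h, by simp, by simp⟩

lemma valid_eq_patF {n : ℕ} (G : SimpleGraph (Fin n)) [DecidableRel G.Adj]
    (htri : G.CliqueFree 3) (L D : Finset (Fin n))
    (hL : ∀ v, v ∈ L ↔ G.degree v = 1) (hD : ∀ v, v ∈ D ↔ ¬ G.degree v = 1)
    (X : Finset (Finset (Fin n)))
    (hX : IsGenPattern n X) (hA : ∀ i j : Fin n, GcdAdj X i j ↔ G.Adj i j) :
    patF G L (D.filter fun i => ({i} : Finset (Fin n)) ∈ X) = X := by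
  have adj : ∀ σ ∈ X, ∀ i ∈ σ, ∀ j ∈ σ, i ≠ j → G.Adj i j := fun σ hσ i hi j hj hij =>
    (hA i j).1 ⟨hij, σ, hσ, hi, hj⟩
  have pair : ∀ σ ∈ X, ∀ i ∈ σ, ∀ j ∈ σ, i ≠ j → σ = {i, j} := by
    intro σ hσ i hi j hj hij
    ext k
    simp only [Finset.mem_insert, Finset.mem_singleton]
    constructor
    · intro hk
      by_contra hc
      rw [not_or] at hc
      apply htri {i, j, k}
      rw [SimpleGraph.is3Clique_triple_iff]
      exact ⟨adj σ hσ i hi j hj hij, adj σ hσ i hi k hk (Ne.symm hc.1),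
        adj σ hσ j hj k hk (Ne.symm hc.2)⟩
    · rintro (rfl | rfl) <;> assumption
  have leaf : ∀ i, G.degree i = 1 → ({i} : Finset (Fin n)) ∈ X := by
    intro i hi
    rw [← G.card_neighborFinset_eq_degree, Finset.card_eq_one] at hi
    obtain ⟨w, hw⟩ := hi
    have hiw : G.Adj i w := by
      rw [← SimpleGraph.mem_neighborFinset, hw]; simp
    obtain ⟨σ, hσ, hi, hwσ⟩ := hX.2 i w hiw.ne
    have : σ = {i} := by
      ext k
      rw [Finset.mem_singleton]
      constructor
      · intro hk
        by_contra hki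
        have h := adj σ hσ i hi k hk (Ne.symm hki)
        rw [← SimpleGraph.mem_neighborFinset, hw, Finset.mem_singleton] at h
        exact hwσ (h ▸ hk)
      · rintro rfl; exact hi
    rwa [← this]
  ext σ
  simp only [patF, Finset.mem_filter, Finset.mem_univ, true_and]
  constructor
  · rintro (⟨i, j, hij, rfl⟩ | ⟨i, hi | hi, rfl⟩)
    · obtain ⟨hne, τ, hτ, hi, hj⟩ := (hA i j).2 hij
      rw [← pair τ hτ i hi j hj hne]
      exact hτ
    · exact leaf i ((hL i).1 hi)
    · exact hi.2
  · intro hσ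
    obtain ⟨i, hi⟩ := hX.1 σ hσ
    by_cases h : ∃ j ∈ σ, i ≠ j
    · obtain ⟨j, hj, hij⟩ := h
      exact Or.inl ⟨i, j, adj σ hσ i hi j hj hij, pair σ hσ i hi j hj hij⟩
    · have hs : σ = {i} := by
        ext k
        rw [Finset.mem_singleton]
        constructor
        · intro hk
          by_contra hki
          exact h ⟨k, hk, Ne.symm hki⟩
        · rintro rfl; exact hi
      refine Or.inr ⟨i, ?_, hs⟩
      rw [hL, hD, ← hs]
      tauto

/-- For a triangle-free graph `G` on `[n]` with minimum degree at least `1` and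
`ℓ` vertices of degree exactly `1`, there are exactly `2^(n-ℓ)` generating patterns
whose GCD graph is `G`. -/
theorem count_patterns_triangle_free (n : ℕ) (G : SimpleGraph (Fin n))
    [DecidableRel G.Adj] (htri : G.CliqueFree 3) (hdeg : ∀ v, 1 ≤ G.degree v) :
    (Finset.univ.filter fun X : Finset (Finset (Fin n)) =>
        IsGenPattern n X ∧ ∀ i j : Fin n, GcdAdj X i j ↔ G.Adj i j).card =
      2 ^ (n - (Finset.univ.filter fun v : Fin n => G.degree v = 1).card) := by
  classical
  set L : Finset (Fin n) := Finset.univ.filter fun v : Fin n => G.degree v = 1 with hLdef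
  set D : Finset (Fin n) := Finset.univ.filter fun v : Fin n => ¬ G.degree v = 1 with hDdef
  have hL : ∀ v, v ∈ L ↔ G.degree v = 1 := by intro v; simp [hLdef]
  have hD : ∀ v, v ∈ D ↔ ¬ G.degree v = 1 := by intro v; simp [hDdef]
  have hc : L.card + D.card = n := by
    have := Finset.card_filter_add_card_filter_not (s := (Finset.univ : Finset (Fin n)))
      (fun v : Fin n => G.degree v = 1)
    rw [Finset.card_univ, Fintype.card_fin] at this
    convert this
  have hn : n - L.card = D.card := by omega
  rw [hn, ← Finset.card_powerset]
  symm
  refine Finset.card_nbij' (fun S => patF G L S)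
    (fun X => D.filter fun i => ({i} : Finset (Fin n)) ∈ X) ?_ ?_ ?_ ?_
  · intro S _
    simpa using patF_valid G hdeg L S hL
  · intro X _
    exact Finset.mem_coe.2 (Finset.mem_powerset.2 (Finset.filter_subset _ _))
  · intro S hS
    have hS' : S ⊆ D := by simpa using hS
    ext i
    simp only [Finset.mem_filter, singleton_mem_patF]
    constructor
    · rintro ⟨h1, h2 | h2⟩
      · exact absurd ((hL i).1 h2) ((hD i).1 h1)
      · exact h2
    · intro h
      exact ⟨hS' h, Or.inr h⟩
  · intro X hX
    have hX' := (Finset.mem_filter.1 (Finset.mem_coe.1 hX)).2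
    exact valid_eq_patF G htri L D hL hD X hX'.1 hX'.2
end
end

section
/- Let X be a generating pattern on [n] and let i, j, ℓ be distinct elements of [n] such that the neighborhood of ℓ in the GCD graph G_X is exactly {i, j}. Then at least one of the following holds: (a) {i,ℓ} ∈ X and {j,ℓ} ∈ X; or (b) {ℓ} ∈ X and {i,j,ℓ} ∈ X. -/
open scoped Classical

noncomputable section

/-- If the neighborhood of `l` in the GCD graph is exactly `{i, j}`, then either
`{i,l}` and `{j,l}` are present, or `{l}` and `{i,j,l}` are present. -/
theorem degree_two_vertex_present (n : ℕ) (X : Finset (Finset (Fin n)))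
    (hX : IsGenPattern n X) (i j l : Fin n)
    (hij : i ≠ j) (hil : i ≠ l) (hjl : j ≠ l)
    (hN : Nbhd X {l} = ({i, j} : Finset (Fin n))) :
    (({i, l} : Finset (Fin n)) ∈ X ∧ ({j, l} : Finset (Fin n)) ∈ X) ∨
    (({l} : Finset (Fin n)) ∈ X ∧ ({i, j, l} : Finset (Fin n)) ∈ X) := by
  have mem : ∀ m, (m = i ∨ m = j) ↔ (l ≠ m ∧ ∃ σ ∈ X, l ∈ σ ∧ m ∈ σ) := by
    intro m
    have h := Finset.ext_iff.mp hN m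
    simp only [Nbhd, GcdAdj, Finset.mem_filter, Finset.mem_univ, true_and,
      Finset.mem_singleton, exists_eq_left, Finset.mem_insert] at h
    exact h.symm
  have sub : ∀ σ ∈ X, l ∈ σ → ∀ m ∈ σ, m = i ∨ m = j ∨ m = l := by
    intro σ hσ hl m hm
    by_cases h : l = m
    · exact Or.inr (Or.inr h.symm)
    · rcases (mem m).mpr ⟨h, σ, hσ, hl, hm⟩ with h | h
      · exact Or.inl h
      · exact Or.inr (Or.inl h)
  have cl : ∀ σ ∈ X, l ∈ σ → ∀ τ : Finset (Fin n), l ∈ τ → (i ∈ τ ↔ i ∈ σ) →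
      (j ∈ τ ↔ j ∈ σ) → (∀ m ∈ τ, m = i ∨ m = j ∨ m = l) → τ ∈ X := by
    intro σ hσ hl τ hlt hi hj ht
    have e : τ = σ := by
      ext m
      constructor
      · intro hm
        rcases ht m hm with rfl | rfl | rfl
        exacts [hi.mp hm, hj.mp hm, hl]
      · intro hm
        rcases sub σ hσ hl m hm with rfl | rfl | rfl
        exacts [hi.mpr hm, hj.mpr hm, hlt]
    exact e ▸ hσ
  obtain ⟨a, ha, hla, hia⟩ := hX.2 l i hil.symm
  obtain ⟨b, hb, hlb, hjb⟩ := hX.2 l j hjl.symm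
  obtain ⟨-, c, hc, hlc, hic⟩ := (mem i).mp (Or.inl rfl)
  obtain ⟨-, d, hd, hld, hjd⟩ := (mem j).mp (Or.inr rfl)
  have A : ({l} : Finset (Fin n)) ∈ X ∨ ({j, l} : Finset (Fin n)) ∈ X := by
    by_cases h : j ∈ a
    · right; apply cl a ha hla <;> simp_all
    · left; apply cl a ha hla <;> simp_all
  have B : ({l} : Finset (Fin n)) ∈ X ∨ ({i, l} : Finset (Fin n)) ∈ X := by
    by_cases h : i ∈ b
    · right; apply cl b hb hlb <;> simp_all [eq_comm] <;> tauto
    · left; apply cl b hb hlb <;> simp_all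
  have C : ({i, j, l} : Finset (Fin n)) ∈ X ∨ ({i, l} : Finset (Fin n)) ∈ X := by
    by_cases h : j ∈ c
    · left; apply cl c hc hlc <;> simp_all
    · right; apply cl c hc hlc <;> simp_all [eq_comm] <;> tauto
  have D : ({i, j, l} : Finset (Fin n)) ∈ X ∨ ({j, l} : Finset (Fin n)) ∈ X := by
    by_cases h : i ∈ d
    · left; apply cl d hd hld <;> simp_all
    · right; apply cl d hd hld <;> simp_all
  tauto
end
end

section
/- Let k be an algebraically closed field, X a generating pattern on [n], σ ⊆ [n], and I ⊆ [n]. Suppose that v_σ is differentially isolated, that every homotopy edge of the Taylor graph with source or target σ is of the form h_{θ,i} with i ∈ I, and that either σ ∪ N(σ) = [n] (homotopy sink case) or σ ⊆ N(σ) (homotopy source case). Then the coordinate subspace {a ∈ k^n : a_i = 0 for all i ∈ I} is contained in V_X. In particular, if some vertex v_σ of the Taylor graph is isolated, then V_X = k^n. -/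
open scoped Classical

noncomputable section

/-- `v_σ` is homotopically isolated: no homotopy edge has source or target `σ`. -/
def HomIsolated {n : ℕ} (X : Finset (Finset (Fin n))) (σ : Finset (Fin n)) : Prop :=
  (∀ i : Fin n, ¬ HomEdge X σ i) ∧
    ∀ (θ : Finset (Fin n)) (i : Fin n), HomEdge X θ i → insert i θ ≠ σ

/-- `v_σ` is differentially isolated: no differential edge has source or target `σ`. -/
def DiffIsolated {n : ℕ} (X : Finset (Finset (Fin n))) (σ : Finset (Fin n)) : Prop :=
  (∀ i : Fin n, ¬ DiffEdge X σ i) ∧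
    ∀ (θ : Finset (Fin n)) (i : Fin n), DiffEdge X θ i → insert i θ ≠ σ


namespace TaylorAux

variable {n : ℕ}

def fl (i : Fin n) (r : Finset (Fin n)) : Finset (Fin n) :=
  if i ∈ r then r.erase i else insert i r

theorem mem_fl (i s : Fin n) (r : Finset (Fin n)) :
    s ∈ fl i r ↔ ((s = i ∧ i ∉ r) ∨ (s ≠ i ∧ s ∈ r)) := by
  unfold fl
  split_ifs with h <;> simp <;> grind

theorem fl_comm (i j : Fin n) (r : Finset (Fin n)) : fl i (fl j r) = fl j (fl i r) := by
  ext s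
  simp only [mem_fl]
  grind

def PP (X : Finset (Finset (Fin n))) (i : Fin n) (r : Finset (Fin n)) : Prop :=
  (i ∈ r → ∀ τ ∈ X, i ∈ τ → ∀ s ∈ τ, s ∈ r → s = i) ∧
  (i ∉ r → ∀ τ ∈ X, i ∈ τ → ∃ s ∈ τ, s ∈ r)

theorem PP_imp (X : Finset (Finset (Fin n))) {i j : Fin n} (hij : i ≠ j) (r : Finset (Fin n))
    (h1 : PP X i r) (h2 : PP X j (fl i r)) : PP X j r ∧ PP X i (fl j r) := by
  obtain ⟨h1a, h1b⟩ := h1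
  obtain ⟨h2a, h2b⟩ := h2
  simp only [mem_fl] at h2a h2b
  unfold PP
  simp only [mem_fl]
  by_cases hi : i ∈ r <;> by_cases hj : j ∈ r <;> simp only [hi, hj, hij, hij.symm, true_and, false_and, and_true, and_false, or_false, false_or, not_true, not_false_eq_true, ne_eq, forall_const, forall_true_left, IsEmpty.forall_iff] at h1a h1b h2a h2b ⊢ <;>
   refine ⟨?_, ?_⟩ <;> grind

theorem PP_diag (X : Finset (Finset (Fin n))) (hc : ∀ i : Fin n, ∃ τ ∈ X, i ∈ τ)
    (i : Fin n) (r : Finset (Fin n))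
    (h1 : PP X i r) (h2 : PP X i (fl i r)) : False := by
  obtain ⟨h1a, h1b⟩ := h1
  obtain ⟨h2a, h2b⟩ := h2
  simp only [mem_fl] at h2a h2b
  obtain ⟨τ, hτ, hiτ⟩ := hc i
  by_cases hi : i ∈ r
  · grind
  · grind

theorem sign_fl (i j : Fin n) (hij : i ≠ j) (r : Finset (Fin n)) :
    edgeSign (fl j r) i = edgeSign r i * (if j < i then -1 else 1) := by
  unfold edgeSign fl
  by_cases hj : j ∈ r
  · rw [if_pos hj]
    by_cases h : j < i
    · rw [if_pos h, Finset.filter_erase]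
      have hm : j ∈ r.filter (fun j => j < i) := by simp [hj, h]
      rw [← Finset.card_erase_add_one hm, pow_succ]
      ring
    · rw [if_neg h, Finset.filter_erase, Finset.erase_eq_of_notMem (by simp [h])]
      ring
  · rw [if_neg hj, Finset.filter_insert]
    by_cases h : j < i
    · rw [if_pos h, if_pos h, Finset.card_insert_of_notMem (by simp [hj]), pow_succ]
    · rw [if_neg h, if_neg h]
      ring

theorem sign_fl_self (i : Fin n) (r : Finset (Fin n)) :
    edgeSign (fl i r) i = edgeSign r i := by
  unfold edgeSign
  congr 2
  ext s
  simp only [Finset.mem_filter, mem_fl]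
  grind

variable {k : Type*} [Field k]

def w (X : Finset (Finset (Fin n))) (a : Fin n → k) (i : Fin n) (r : Finset (Fin n)) : k :=
  if PP X i r then (edgeSign r i : k) * (if i ∈ r then a i else 1) else 0

theorem w_diag (X : Finset (Finset (Fin n))) (hc : ∀ i : Fin n, ∃ τ ∈ X, i ∈ τ) (a : Fin n → k)
    (i : Fin n) (r : Finset (Fin n)) : w X a i r * w X a i (fl i r) = 0 := by
  unfold w
  split_ifs with h1 h2 <;> first | exact (PP_diag X hc i r ‹_› ‹_›).elim | simp

theorem w_anti (X : Finset (Finset (Fin n))) (a : Fin n → k) {i j : Fin n} (hij : i ≠ j)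
    (r : Finset (Fin n)) :
    w X a i r * w X a j (fl i r) + w X a j r * w X a i (fl j r) = 0 := by
  by_cases h : PP X i r ∧ PP X j (fl i r)
  · have h' := PP_imp X hij r h.1 h.2
    unfold w
    rw [if_pos h.1, if_pos h.2, if_pos h'.1, if_pos h'.2, sign_fl i j hij, sign_fl j i hij.symm]
    have e1 : (j ∈ fl i r) = (j ∈ r) := by simp [mem_fl, hij, hij.symm]
    have e2 : (i ∈ fl j r) = (i ∈ r) := by simp [mem_fl, hij]
    simp only [e1, e2]
    rcases lt_or_gt_of_ne hij with hl | hl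
    · rw [if_pos hl, if_neg hl.not_gt]; push_cast; ring
    · rw [if_pos hl, if_neg hl.not_gt]; push_cast; ring
  · have h' : ¬ (PP X j r ∧ PP X i (fl j r)) := fun h' => h (PP_imp X hij.symm r h'.1 h'.2)
    have : ∀ {i j : Fin n}, ¬ (PP X i r ∧ PP X j (fl i r)) →
        w X a i r * w X a j (fl i r) = 0 := by
      intro i j h
      unfold w
      split_ifs <;> first | exact (h ⟨‹_›, ‹_›⟩).elim | simp
    rw [this h, this h', add_zero]

theorem diff_iff (X : Finset (Finset (Fin n))) (r : Finset (Fin n)) (i : Fin n) :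
    DiffEdge X r i ↔ i ∉ r ∧ PP X i r := by
  unfold DiffEdge PP
  simp only [Finset.Nonempty, Finset.mem_inter]
  grind

theorem hom_iff (X : Finset (Finset (Fin n))) (c : Finset (Fin n)) (i : Fin n) :
    HomEdge X c i ↔ i ∉ c ∧ PP X i (insert i c) := by
  unfold HomEdge PP Nbhd GcdAdj
  simp only [Finset.mem_filter, Finset.mem_univ, true_and, Finset.mem_insert]
  refine and_congr_right fun hi => ?_
  constructor
  · intro h
    refine ⟨fun _ τ hτ hiτ s hs hsr => ?_, by simp⟩
    by_contra hsi
    exact h ⟨s, by tauto, hsi, τ, hτ, hs, hiτ⟩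
  · rintro ⟨h, -⟩ ⟨s, hs, hsi, τ, hτ, hsτ, hiτ⟩
    exact hsi (h (by simp) τ hτ hiτ s hsτ (Or.inr hs))

theorem entry (X : Finset (Finset (Fin n))) (a : Fin n → k) (r c : Finset (Fin n)) :
    taylorMatrixAt X a r c = ∑ i, if c = fl i r then w X a i r else 0 := by
  unfold taylorMatrixAt
  rw [← Finset.sum_add_distrib]
  refine Finset.sum_congr rfl fun i _ => ?_
  rw [diff_iff, hom_iff]
  by_cases hi : i ∈ r
  · have hf : fl i r = r.erase i := by simp [fl, hi]
    rw [if_neg (by tauto), zero_add]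
    by_cases hc : c = fl i r
    · have hs := sign_fl_self i r
      rw [if_pos hc]
      subst hc
      have hins : insert i (fl i r) = r := by rw [hf, Finset.insert_erase hi]
      have hnm : i ∉ fl i r := by simp [hf]
      unfold w
      rw [hins, hs]
      simp [hi, hnm]
    · rw [if_neg hc, if_neg]
      rintro ⟨h1, h2, h3⟩
      apply hc
      rw [hf, h1, Finset.erase_insert h2]
  · have hf : fl i r = insert i r := by simp [fl, hi]
    have : ¬ (r = insert i c ∧ i ∉ c ∧ PP X i (insert i c)) := by
      rintro ⟨h1, -⟩
      exact hi (h1 ▸ Finset.mem_insert_self i c)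
    rw [if_neg this, add_zero, hf]
    unfold w
    by_cases hc : c = insert i r <;> simp [hc, hi]

theorem sq_zero (X : Finset (Finset (Fin n))) (hc : ∀ i : Fin n, ∃ τ ∈ X, i ∈ τ) (a : Fin n → k) :
    taylorMatrixAt X a * taylorMatrixAt X a = 0 := by
  ext r c
  rw [Matrix.mul_apply, Matrix.zero_apply]
  have h1 : ∀ s, taylorMatrixAt X a r s * taylorMatrixAt X a s c
      = ∑ i, if s = fl i r then w X a i r * taylorMatrixAt X a s c else 0 := by
    intro s
    rw [entry X a r s, Finset.sum_mul]
    simp only [ite_mul, zero_mul]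
  simp only [h1]
  rw [Finset.sum_comm]
  simp only [Finset.sum_ite_eq', Finset.sum_ite_eq, Finset.mem_univ, if_true]
  simp only [entry, Finset.mul_sum]
  rw [← Finset.sum_product']
  refine Finset.sum_involution (fun p _ => (p.2, p.1)) ?_ ?_ ?_ ?_
  · rintro ⟨i, j⟩ -
    dsimp only
    rw [fl_comm j i]
    by_cases hij : i = j
    · subst hij
      simp [w_diag X hc]
    · by_cases h : c = fl i (fl j r)
      · simpa [h] using w_anti X a hij r
      · simp [h]
  · rintro ⟨i, j⟩ - hne heq
    simp only [Prod.mk.injEq] at heq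
    obtain ⟨rfl, -⟩ := heq
    apply hne
    simp [w_diag X hc]
  · simp
  · simp

theorem main (X : Finset (Finset (Fin n))) (σ I : Finset (Fin n)) (hD : DiffIsolated X σ)
    (h1 : ∀ i : Fin n, HomEdge X σ i → i ∈ I)
    (h2 : ∀ (θ : Finset (Fin n)) (i : Fin n), HomEdge X θ i → insert i θ = σ → i ∈ I)
    (a : Fin n → k) (ha : ∀ i ∈ I, a i = 0) : a ∈ supportVariety k X := by
  have hc : ∀ i : Fin n, ∃ τ ∈ X, i ∈ τ := by
    intro i
    by_contra hcon
    push Not at hcon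
    by_cases hi : i ∈ σ
    · exact hD.2 (σ.erase i) i ⟨by simp, fun τ hτ h => (hcon τ hτ h).elim⟩
        (Finset.insert_erase hi)
    · exact hD.1 i ⟨hi, fun τ hτ h => (hcon τ hτ h).elim⟩
  have hsq := sq_zero X hc a
  have hrow : ∀ c, taylorMatrixAt X a σ c = 0 := by
    intro c
    unfold taylorMatrixAt
    rw [Finset.sum_eq_zero, Finset.sum_eq_zero, add_zero]
    · intro i _
      split_ifs with h
      · rw [ha i (h2 c i h.2 h.1.symm), mul_zero]
      · rfl
    · intro i _
      rw [if_neg fun h => hD.1 i h.2]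
  have hcol : ∀ r, taylorMatrixAt X a r σ = 0 := by
    intro r
    unfold taylorMatrixAt
    rw [Finset.sum_eq_zero, Finset.sum_eq_zero, add_zero]
    · intro i _
      split_ifs with h
      · rw [ha i (h1 i h.2), mul_zero]
      · rfl
    · intro i _
      rw [if_neg fun h => hD.2 r i h.2 h.1.symm]
  set T := taylorMatrixAt X a with hT
  have hlt : LinearMap.range T.mulVecLin < LinearMap.ker T.mulVecLin := by
    refine lt_of_le_of_ne ?_ ?_
    · rintro _ ⟨v, rfl⟩
      simp [LinearMap.mem_ker, Matrix.mulVec_mulVec, hsq]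
    · intro heq
      have hm : (Pi.single σ 1 : Finset (Fin n) → k) ∈ LinearMap.ker T.mulVecLin := by
        rw [LinearMap.mem_ker]
        ext r
        simp [hcol]
      rw [← heq] at hm
      obtain ⟨v, hv⟩ := hm
      have := congrFun hv σ
      simp [Matrix.mulVec, dotProduct, hrow] at this
  have hfr := Submodule.finrank_lt_finrank_of_lt hlt
  have hsum := LinearMap.finrank_range_add_finrank_ker T.mulVecLin
  have hcard : Module.finrank k (Finset (Fin n) → k) = 2 ^ n := by simp
  rw [hcard] at hsum
  have hrk : T.rank < 2 ^ (n - 1) := by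
    unfold Matrix.rank
    cases n with
    | zero => rw [pow_zero] at hsum; simp only [Nat.zero_sub, pow_zero]; omega
    | succ m => rw [pow_succ] at hsum; simp only [Nat.add_sub_cancel]; omega
  intro f g _ _
  by_contra hdet
  have hu := Matrix.rank_of_isUnit (T.submatrix f g)
    ((Matrix.isUnit_iff_isUnit_det _).2 (isUnit_iff_ne_zero.2 hdet))
  have hle := Matrix.rank_submatrix_le T f g
  rw [hu, Fintype.card_fin] at hle
  omega

end TaylorAux

/-- A homotopy source or sink for the variables indexed by `I` gives the coordinate
subspace `{a : a_i = 0 for i ∈ I}` inside the support variety; in particular an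
isolated vertex of the Taylor graph forces the support variety to be everything. -/
theorem homotopy_source_sink_subvariety (n : ℕ) (k : Type*) [Field k] [IsAlgClosed k]
    (X : Finset (Finset (Fin n))) (hX : IsGenPattern n X) :
    (∀ (σ I : Finset (Fin n)),
      DiffIsolated X σ →
      (∀ i : Fin n, HomEdge X σ i → i ∈ I) →
      (∀ (θ : Finset (Fin n)) (i : Fin n), HomEdge X θ i → insert i θ = σ → i ∈ I) →
      (σ ∪ Nbhd X σ = Finset.univ ∨ σ ⊆ Nbhd X σ) →
      {a : Fin n → k | ∀ i ∈ I, a i = 0} ⊆ supportVariety k X) ∧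
    (∀ σ : Finset (Fin n), HomIsolated X σ → DiffIsolated X σ →
      supportVariety k X = Set.univ) := by
  refine ⟨fun σ I hD h1 h2 _ a ha => TaylorAux.main X σ I hD h1 h2 a ha, ?_⟩
  intro σ hH hD
  refine Set.eq_univ_of_forall fun a => TaylorAux.main X σ ∅ hD ?_ ?_ a (by simp)
  · exact fun i h => (hH.1 i h).elim
  · exact fun θ i h he => (hH.2 θ i h he).elim
end
end

section
/- Let k be a field, m ≥ 1, and let T be an m × m matrix over k with T² = 0. Let S be a set of indices such that for every s ∈ S the s-th row of T is zero, and let N = {r : T_{r,s} ≠ 0 for some s ∈ S}. If |S| > |N|, then the column space of T is strictly contained in the kernel of T; equivalently, rank T < m/2. -/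
open scoped Classical

/-- If `T² = 0`, `S` is a set of indices whose rows vanish (sources), and the set
`N = {r : T_{r,s} ≠ 0 for some s ∈ S}` of their neighbors is smaller than `S`, then the
column space of `T` is strictly contained in its kernel; equivalently `rank T < m/2`. -/
theorem more_sources_than_neighbors (k : Type*) [Field k] (m : ℕ) (hm : 1 ≤ m)
    (T : Matrix (Fin m) (Fin m) k) (hT : T * T = 0)
    (S : Finset (Fin m)) (hS : ∀ s ∈ S, ∀ c : Fin m, T s c = 0)
    (hcard : (Finset.univ.filter fun r : Fin m => ∃ s ∈ S, T r s ≠ 0).card < S.card) :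
    LinearMap.range T.mulVecLin < LinearMap.ker T.mulVecLin ∧ 2 * T.rank < m := by
  classical
  set N := (Finset.univ.filter fun r : Fin m => ∃ s ∈ S, T r s ≠ 0) with hN
  have hker : LinearMap.ker (Matrix.mulVecLin (fun (r : N) (s : S) => T r s : Matrix N S k)) ≠ ⊥ := by
    apply LinearMap.ker_ne_bot_of_finrank_lt
    simpa using hcard
  obtain ⟨y, hy, hy0⟩ := (Submodule.ne_bot_iff _).1 hker
  let x : Fin m → k := fun i => if h : i ∈ S then y ⟨i, h⟩ else 0
  have hsum : ∀ r, (T.mulVec x) r = ∑ s : S, T r s * y s := by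
    intro r
    have h1 : (T.mulVec x) r = ∑ i, T r i * x i := rfl
    rw [h1, ← Finset.sum_subset (Finset.subset_univ S), ← Finset.sum_coe_sort S]
    · apply Finset.sum_congr rfl
      intro s _
      simp [x]
    · intro i _ hi
      simp [x, hi]
  have hx : x ∈ LinearMap.ker T.mulVecLin := by
    rw [LinearMap.mem_ker, Matrix.mulVecLin_apply]
    funext r
    rw [hsum]
    by_cases hr : r ∈ N
    · exact congrFun (LinearMap.mem_ker.1 hy) ⟨r, hr⟩
    · apply Finset.sum_eq_zero
      intro s _
      have : T r s = 0 := by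
        by_contra h
        exact hr (by simp only [hN, Finset.mem_filter, Finset.mem_univ, true_and]; exact ⟨s, s.2, h⟩)
      simp [this]
  have hxr : x ∉ LinearMap.range T.mulVecLin := by
    rintro ⟨z, hz⟩
    apply hy0
    funext s
    have h1 : x s = y s := by simp [x]
    have h2 : x s = ∑ i, T s i * z i := by rw [← hz]; rfl
    rw [← h1, h2]
    exact Finset.sum_eq_zero fun i _ => by rw [hS s s.2 i, zero_mul]
  have hle : LinearMap.range T.mulVecLin ≤ LinearMap.ker T.mulVecLin := by
    rintro _ ⟨z, rfl⟩
    simp [LinearMap.mem_ker, Matrix.mulVec_mulVec, hT]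
  have hlt : LinearMap.range T.mulVecLin < LinearMap.ker T.mulVecLin :=
    lt_of_le_of_ne hle fun h => hxr (h ▸ hx)
  refine ⟨hlt, ?_⟩
  have h1 := Submodule.finrank_lt_finrank_of_lt hlt
  have h2 := LinearMap.finrank_range_add_finrank_ker T.mulVecLin
  rw [Module.finrank_fin_fun] at h2
  unfold Matrix.rank
  omega
end

section
/- Let k be a field, m ≥ 1, and let T be an m × m matrix over k with T² = 0. Let S be a set of indices such that for every s ∈ S the s-th column of T is zero, and let N = {c : T_{s,c} ≠ 0 for some s ∈ S}. If |S| > |N|, then the column space of T is strictly contained in the kernel of T; equivalently, rank T < m/2. -/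
open scoped Classical

/-- If `T² = 0`, `S` is a set of indices whose columns vanish (sinks), and the set
`N = {c : T_{s,c} ≠ 0 for some s ∈ S}` of sources of edges into `S` is smaller than `S`,
then the column space of `T` is strictly contained in its kernel; equivalently
`rank T < m/2`. -/
theorem more_sinks_than_sources (k : Type*) [Field k] (m : ℕ) (hm : 1 ≤ m)
    (T : Matrix (Fin m) (Fin m) k) (hT : T * T = 0)
    (S : Finset (Fin m)) (hS : ∀ s ∈ S, ∀ r : Fin m, T r s = 0)
    (hcard : (Finset.univ.filter fun c : Fin m => ∃ s ∈ S, T s c ≠ 0).card < S.card) :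
    LinearMap.range T.mulVecLin < LinearMap.ker T.mulVecLin ∧ 2 * T.rank < m := by
  have hle : LinearMap.range T.mulVecLin ≤ LinearMap.ker T.mulVecLin := by
    rintro _ ⟨v, rfl⟩
    simp [LinearMap.mem_ker, Matrix.mulVec_mulVec, hT]
  have hlt : LinearMap.range T.mulVecLin < LinearMap.ker T.mulVecLin := by
    refine lt_of_le_not_ge hle fun hge => ?_
    set N : Finset (Fin m) := Finset.univ.filter fun c : Fin m => ∃ s ∈ S, T s c ≠ 0 with hN
    let B : Matrix S N k := Matrix.of fun s c => T s.1 c.1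
    have hsurj : Function.Surjective B.mulVecLin := by
      intro f
      let e : Fin m → k := fun i => if h : i ∈ S then f ⟨i, h⟩ else 0
      have he : e ∈ LinearMap.ker T.mulVecLin := by
        rw [LinearMap.mem_ker]
        funext r
        simp only [Matrix.mulVecLin_apply, Matrix.mulVec, dotProduct, Pi.zero_apply]
        refine Finset.sum_eq_zero fun i _ => ?_
        by_cases h : i ∈ S
        · rw [hS i h r, zero_mul]
        · simp [e, h]
      obtain ⟨v, hv⟩ := hge he
      refine ⟨fun c => v c.1, ?_⟩
      funext s
      have h1 : (T.mulVecLin v) s.1 = f s := by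
        rw [hv]; simp [e]
      rw [← h1]
      simp only [Matrix.mulVecLin_apply, Matrix.mulVec, dotProduct, B, Matrix.of_apply]
      rw [Finset.sum_coe_sort N (fun c => T s.1 c * v c)]
      refine Finset.sum_subset (Finset.subset_univ _) fun c _ hc => ?_
      have : T s.1 c = 0 := by
        by_contra h
        exact hc (by rw [hN, Finset.mem_filter]; exact ⟨Finset.mem_univ _, s.1, s.2, h⟩)
      rw [this, zero_mul]
    have h2 := LinearMap.finrank_le_finrank_of_surjective hsurj
    simp only [Module.finrank_fintype_fun_eq_card, Fintype.card_coe] at h2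
    omega
  refine ⟨hlt, ?_⟩
  have h3 := Submodule.finrank_lt_finrank_of_lt hlt
  have h4 := LinearMap.finrank_range_add_finrank_ker T.mulVecLin
  rw [Module.finrank_fintype_fun_eq_card, Fintype.card_fin] at h4
  unfold Matrix.rank
  omega
end

section
/- Let n ≥ 1 and let K be an abstract simplicial complex on [n] (a collection of subsets of [n] closed under taking subsets) such that every singleton {i} with i ∈ [n] is a face of K and every facet (face maximal under inclusion) of K has at least 3 elements. Let X be a set of nonempty faces of K such that for every facet σ of K and every i ∈ σ, the set σ ∖ {i} belongs to X. Then X is a generating pattern on [n], and the GCD graph G_X equals the 1-skeleton of K: distinct vertices i and j are adjacent in G_X if and only if {i,j} ∈ K. -/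
open scoped Classical

noncomputable section

/-- If `K` is a simplicial complex on `[n]` containing every singleton, all of whose
facets have at least `3` elements, and `X` is a set of nonempty faces of `K` containing
`σ ∖ {i}` for every facet `σ` and `i ∈ σ`, then `X` is a generating pattern whose GCD
graph is the `1`-skeleton of `K`. -/
theorem boundary_faces_present_gcd_graph (n : ℕ) (hn : 1 ≤ n)
    (K : Finset (Finset (Fin n)))
    (hdown : ∀ s ∈ K, ∀ t ⊆ s, t ∈ K)
    (hvert : ∀ i : Fin n, ({i} : Finset (Fin n)) ∈ K)
    (hfacet : ∀ s ∈ K, (∀ t ∈ K, s ⊆ t → s = t) → 3 ≤ s.card)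
    (X : Finset (Finset (Fin n)))
    (hXfaces : ∀ σ ∈ X, σ ∈ K ∧ σ.Nonempty)
    (hXbd : ∀ s ∈ K, (∀ t ∈ K, s ⊆ t → s = t) → ∀ i ∈ s, s.erase i ∈ X) :
    IsGenPattern n X ∧
      ∀ i j : Fin n, GcdAdj X i j ↔ (i ≠ j ∧ ({i, j} : Finset (Fin n)) ∈ K) := by
  have ext : ∀ s ∈ K, ∃ t ∈ K, s ⊆ t ∧ (∀ u ∈ K, t ⊆ u → t = u) := by
    intro s hs
    obtain ⟨t, hst, ht⟩ := K.exists_le_maximal hs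
    exact ⟨t, ht.prop, hst, fun u hu htu => le_antisymm htu (ht.le_of_ge hu htu)⟩
  have third : ∀ t : Finset (Fin n), 3 ≤ t.card → ∀ i j : Fin n, ∃ k ∈ t, k ≠ i ∧ k ≠ j := by
    intro t ht i j
    have h2 : ({i, j} : Finset (Fin n)).card < t.card :=
      lt_of_le_of_lt Finset.card_le_two (by omega)
    obtain ⟨k, hk, hk2⟩ := Finset.exists_mem_notMem_of_card_lt_card h2
    simp only [Finset.mem_insert, Finset.mem_singleton, not_or] at hk2
    exact ⟨k, hk, hk2⟩
  refine ⟨⟨fun σ hσ => (hXfaces σ hσ).2, ?_⟩, ?_⟩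
  · intro i j hij
    obtain ⟨t, ht, hit, hmax⟩ := ext _ (hvert i)
    have hi : i ∈ t := hit (Finset.mem_singleton_self i)
    by_cases hj : j ∈ t
    · exact ⟨_, hXbd t ht hmax j hj, Finset.mem_erase.2 ⟨hij, hi⟩, Finset.notMem_erase j t⟩
    · obtain ⟨k, hk, hki, -⟩ := third t (hfacet t ht hmax) i j
      exact ⟨_, hXbd t ht hmax k hk, Finset.mem_erase.2 ⟨hki.symm, hi⟩,
        fun h => hj (Finset.mem_of_mem_erase h)⟩
  · intro i j
    constructor
    · rintro ⟨hij, σ, hσ, hi, hj⟩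
      refine ⟨hij, hdown σ (hXfaces σ hσ).1 _ ?_⟩
      intro x hx
      simp only [Finset.mem_insert, Finset.mem_singleton] at hx
      rcases hx with rfl | rfl <;> assumption
    · rintro ⟨hij, hK⟩
      obtain ⟨t, ht, hit, hmax⟩ := ext _ hK
      have hi : i ∈ t := hit (by simp)
      have hj : j ∈ t := hit (by simp)
      obtain ⟨k, hk, hki, hkj⟩ := third t (hfacet t ht hmax) i j
      exact ⟨hij, _, hXbd t ht hmax k hk, Finset.mem_erase.2 ⟨hki.symm, hi⟩,
        Finset.mem_erase.2 ⟨hkj.symm, hj⟩⟩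
end
end

section
/- Let k be an algebraically closed field and X a generating pattern on [n]. Let E be the set of edges σ of the GCD graph G_X (two-element subsets whose elements are adjacent) such that v_σ is homotopically isolated (equivalently, N(σ) = [n]), and let T be the set of triangles θ of G_X (three-element subsets that are pairwise adjacent) such that v_θ is homotopically isolated. If |E| > |T|, then V_X = k^n. -/
open scoped Classical

noncomputable section

namespace TaylorAux

variable {n : ℕ} {k : Type*} [Field k]

lemma adj_symm {X : Finset (Finset (Fin n))} {i j : Fin n} (h : GcdAdj X i j) : GcdAdj X j i :=
  ⟨h.1.symm, h.2.imp fun _ h => ⟨h.1, h.2.2, h.2.1⟩⟩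

/-- Toggle membership of `i`. -/
def tog (r : Finset (Fin n)) (i : Fin n) : Finset (Fin n) :=
  if i ∈ r then r.erase i else insert i r

lemma mem_tog (r : Finset (Fin n)) (i j : Fin n) :
    j ∈ tog r i ↔ (j = i ∧ i ∉ r) ∨ (j ≠ i ∧ j ∈ r) := by
  unfold tog
  split_ifs with h <;> simp <;> grind

lemma tog_comm (r : Finset (Fin n)) (i j : Fin n) : tog (tog r i) j = tog (tog r j) i := by
  ext x
  simp only [mem_tog]
  grind

/-- The edge into row `r` along direction `i` exists. -/
def P (X : Finset (Finset (Fin n))) (i : Fin n) (r : Finset (Fin n)) : Prop :=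
  if i ∈ r then HomEdge X (r.erase i) i else DiffEdge X r i

lemma P_iff (X : Finset (Finset (Fin n))) (i : Fin n) (r : Finset (Fin n)) :
    P X i r ↔ (i ∈ r ∧ ∀ m ∈ r, m ≠ i → ∀ τ ∈ X, m ∈ τ → i ∉ τ) ∨
      (i ∉ r ∧ ∀ τ ∈ X, i ∈ τ → ∃ m ∈ r, m ∈ τ) := by
  unfold P
  split_ifs with h
  · simp only [HomEdge, Nbhd, GcdAdj, h]
    simp
    grind
  · simp only [DiffEdge, h, Finset.Nonempty, Finset.mem_inter]
    simp
    grind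

lemma P_swap1 (X : Finset (Finset (Fin n))) (i j : Fin n) (hij : i ≠ j) (r : Finset (Fin n))
    (h : P X i r ∧ P X j (tog r i)) : P X j r ∧ P X i (tog r j) := by
  simp only [P_iff, mem_tog] at h ⊢
  by_cases hi : i ∈ r <;> by_cases hj : j ∈ r <;>
    simp only [hi, hj, hij, hij.symm, not_true_eq_false, not_false_eq_true, false_and, true_and,
      and_false, and_true, or_false, false_or, ne_eq] at h ⊢
  · grind
  · grind
  · grind
  · grind

lemma P_diag (X : Finset (Finset (Fin n))) (hX : ∀ i, ∃ σ ∈ X, i ∈ σ) (i : Fin n)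
    (r : Finset (Fin n)) (h : P X i r ∧ P X i (tog r i)) : False := by
  obtain ⟨τ, hτ, hi⟩ := hX i
  simp only [P_iff, mem_tog] at h
  grind

/-- coefficient -/
def co (X : Finset (Finset (Fin n))) (a : Fin n → k) (i : Fin n) (r : Finset (Fin n)) : k :=
  if P X i r then (edgeSign r i : k) * (if i ∈ r then a i else 1) else 0

lemma sign_tog (r : Finset (Fin n)) (i j : Fin n) :
    edgeSign (tog r i) j = edgeSign r j * (if i < j then -1 else 1) := by
  unfold edgeSign
  split_ifs with h
  · unfold tog
    split_ifs with hi
    · rw [Finset.filter_erase]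
      have hm : i ∈ r.filter (fun x => x < j) := by simp [hi, h]
      rw [← Finset.card_erase_add_one hm, pow_succ]
      ring
    · rw [Finset.filter_insert, if_pos h, Finset.card_insert_of_notMem (by simp [hi]), pow_succ]
  · have : (tog r i).filter (fun x => x < j) = r.filter (fun x => x < j) := by
      ext x
      simp only [Finset.mem_filter, mem_tog]
      grind
    rw [this, mul_one]

lemma co_swap (X : Finset (Finset (Fin n))) (a : Fin n → k) (i j : Fin n) (hij : i ≠ j)
    (r : Finset (Fin n)) :
    co X a i r * co X a j (tog r i) = - (co X a j r * co X a i (tog r j)) := by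
  have hP : (P X i r ∧ P X j (tog r i)) ↔ (P X j r ∧ P X i (tog r j)) :=
    ⟨P_swap1 X i j hij r, P_swap1 X j i hij.symm r⟩
  unfold co
  have e1 : j ∈ tog r i ↔ j ∈ r := by simp [mem_tog, hij.symm]
  have e2 : i ∈ tog r j ↔ i ∈ r := by simp [mem_tog, hij]
  simp only [e1, e2, sign_tog]
  by_cases h : P X i r ∧ P X j (tog r i)
  · have h' := hP.1 h
    simp only [h.1, h.2, h'.1, h'.2, if_true]
    rcases lt_or_gt_of_ne hij with hl | hl
    · simp only [hl, hl.not_gt, if_true, if_false]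
      push_cast
      ring
    · simp only [hl, hl.not_gt, if_true, if_false]
      push_cast
      ring
  · have h' := fun q => h (hP.2 q)
    grind

lemma taylor_eq (X : Finset (Finset (Fin n))) (a : Fin n → k) (r c : Finset (Fin n)) :
    taylorMatrixAt X a r c = ∑ i, if c = tog r i then co X a i r else 0 := by
  unfold taylorMatrixAt
  rw [← Finset.sum_add_distrib]
  refine Finset.sum_congr rfl fun i _ => ?_
  unfold co tog P
  by_cases hi : i ∈ r
  · have h1 : ¬ DiffEdge X r i := fun h => h.1 hi
    simp only [h1, and_false, if_false, zero_add, hi, if_true]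
    by_cases hc : c = r.erase i
    · have : r = insert i c := by rw [hc, Finset.insert_erase hi]
      have hs : edgeSign c i = edgeSign r i := by
        have := sign_tog r i i
        simp only [tog, hi, if_true, lt_irrefl, if_false, mul_one] at this
        rw [hc, this]
      rw [hs]
      simp [hc, Finset.insert_erase hi]
    · have : ¬ (r = insert i c ∧ HomEdge X c i) := by
        rintro ⟨h, h2⟩
        apply hc
        rw [h, Finset.erase_insert h2.1]
      simp [hc, this]
  · have h2 : ¬ (r = insert i c ∧ HomEdge X c i) := by
      rintro ⟨h, _⟩
      exact hi (h ▸ Finset.mem_insert_self _ _)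
    simp only [h2, if_false, add_zero, hi, mul_one]
    by_cases hc : c = insert i r <;> simp [hc]

lemma taylor_mulVec (X : Finset (Finset (Fin n))) (a : Fin n → k) (v : Finset (Fin n) → k)
    (r : Finset (Fin n)) :
    (taylorMatrixAt X a).mulVec v r = ∑ i, co X a i r * v (tog r i) := by
  simp only [Matrix.mulVec, dotProduct, taylor_eq, Finset.sum_mul]
  rw [Finset.sum_comm]
  refine Finset.sum_congr rfl fun i _ => ?_
  simp [ite_mul]

lemma taylor_sq (X : Finset (Finset (Fin n))) (hX : ∀ i, ∃ σ ∈ X, i ∈ σ) (a : Fin n → k)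
    (v : Finset (Fin n) → k) :
    (taylorMatrixAt X a).mulVec ((taylorMatrixAt X a).mulVec v) = 0 := by
  ext r
  simp only [taylor_mulVec, Finset.mul_sum, Pi.zero_apply]
  rw [← Finset.sum_product']
  refine Finset.sum_involution (fun p _ => (p.2, p.1)) ?_ ?_ ?_ ?_
  · rintro ⟨i, j⟩ _
    by_cases hij : i = j
    · subst hij
      have : co X a i r * co X a i (tog r i) = 0 := by
        have := P_diag X hX i r
        unfold co
        grind
      simp only [← mul_assoc, this, zero_mul, add_zero]
    · simp only [← mul_assoc]
      rw [co_swap X a i j hij, tog_comm r i j]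
      ring
  · rintro ⟨i, j⟩ _ h he
    have hij : j = i := (Prod.mk.inj he).1
    subst hij
    apply h
    have : co X a j r * co X a j (tog r j) = 0 := by
      have := P_diag X hX j r
      unfold co
      grind
    simp only [← mul_assoc, this, zero_mul]
  · simp
  · simp

end TaylorAux

open TaylorAux in
/-- If there are more homotopically isolated edges of the GCD graph than homotopically
isolated triangles, the support variety is everything. -/
theorem more_isolated_edges_than_triangles (n : ℕ) (k : Type*) [Field k] [IsAlgClosed k]
    (X : Finset (Finset (Fin n))) (hX : IsGenPattern n X)
    (hcard :
      (Finset.univ.filter fun σ : Finset (Fin n) =>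
          (∃ i j : Fin n, GcdAdj X i j ∧ σ = ({i, j} : Finset (Fin n))) ∧
            HomIsolated X σ).card >
        (Finset.univ.filter fun θ : Finset (Fin n) =>
          (∃ i j l : Fin n, GcdAdj X i j ∧ GcdAdj X j l ∧ GcdAdj X i l ∧
              θ = ({i, j, l} : Finset (Fin n))) ∧
            HomIsolated X θ).card) :
    supportVariety k X = Set.univ := by
  have hex : ∀ i : Fin n, ∃ σ ∈ X, i ∈ σ := by
    obtain ⟨σ, hσ⟩ := Finset.card_pos.1 (lt_of_le_of_lt (Nat.zero_le _) hcard)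
    obtain ⟨p, q, hpq, -⟩ := (Finset.mem_filter.1 hσ).2.1
    intro i
    by_cases h : i = p
    · obtain ⟨τ, h1, h2, -⟩ := hX.2 i q (h ▸ hpq.1)
      exact ⟨τ, h1, h2⟩
    · obtain ⟨τ, h1, h2, -⟩ := hX.2 i p h
      exact ⟨τ, h1, h2⟩
  have hn : 0 < n := by
    obtain ⟨σ, hσ⟩ := Finset.card_pos.1 (lt_of_le_of_lt (Nat.zero_le _) hcard)
    obtain ⟨p, q, hpq, -⟩ := (Finset.mem_filter.1 hσ).2.1
    exact p.pos
  set E := (Finset.univ.filter fun σ : Finset (Fin n) =>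
          (∃ i j : Fin n, GcdAdj X i j ∧ σ = ({i, j} : Finset (Fin n))) ∧
            HomIsolated X σ) with hE
  set T := (Finset.univ.filter fun θ : Finset (Fin n) =>
          (∃ i j l : Fin n, GcdAdj X i j ∧ GcdAdj X j l ∧ GcdAdj X i l ∧
              θ = ({i, j, l} : Finset (Fin n))) ∧
            HomIsolated X θ) with hT
  rw [Set.eq_univ_iff_forall]
  intro a f g hf hg
  by_contra hdet
  set M := taylorMatrixAt X a with hM
  -- columns in E vanish
  have hcol : ∀ σ ∈ E, ∀ r, M r σ = 0 := by
    intro σ hσ r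
    obtain ⟨⟨p, q, hpq, rfl⟩, hiso⟩ := (Finset.mem_filter.1 hσ).2
    rw [hM, taylorMatrixAt]
    rw [Finset.sum_eq_zero, Finset.sum_eq_zero, add_zero]
    · intro i _
      rw [if_neg]
      exact fun h => hiso.1 i h.2
    · intro i _
      rw [if_neg]
      rintro ⟨h1, h2, h3⟩
      have hi : i ∈ ({p, q} : Finset (Fin n)) := h1 ▸ Finset.mem_insert_self _ _
      have hr : r = ({p, q} : Finset (Fin n)).erase i := by rw [h1, Finset.erase_insert h2]
      have key : ∃ j, i ≠ j ∧ ∀ m ∈ r, m = j := by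
        rw [hr]
        simp only [Finset.mem_insert, Finset.mem_singleton] at hi
        rcases hi with rfl | rfl
        · exact ⟨q, hpq.1, by simp⟩
        · exact ⟨p, hpq.1.symm, by simp; grind⟩
      obtain ⟨j, hij, hj⟩ := key
      obtain ⟨τ, ht, hiτ, hjτ⟩ := hX.2 i j hij
      obtain ⟨m, hm⟩ := h3 τ ht hiτ
      rw [Finset.mem_inter] at hm
      exact hjτ (hj m hm.2 ▸ hm.1)
  -- rows in E are supported on T
  have hrow : ∀ σ ∈ E, ∀ s, s ∉ T → M σ s = 0 := by
    intro σ hσ s hs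
    obtain ⟨⟨p, q, hpq, rfl⟩, hiso⟩ := (Finset.mem_filter.1 hσ).2
    rw [hM, taylorMatrixAt]
    rw [Finset.sum_eq_zero, Finset.sum_eq_zero, add_zero]
    · intro i _
      rw [if_neg]
      exact fun h => hiso.2 s i h.2 h.1.symm
    · intro i _
      rw [if_neg]
      rintro ⟨h1, h2, h3⟩
      apply hs
      simp only [Finset.mem_insert, Finset.mem_singleton, not_or] at h2
      have hip : GcdAdj X i p := by
        refine ⟨h2.1, ?_⟩
        obtain ⟨τ, ht, hiτ, hjτ⟩ := hX.2 i q h2.2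
        obtain ⟨m, hm⟩ := h3 τ ht hiτ
        simp only [Finset.mem_inter, Finset.mem_insert, Finset.mem_singleton] at hm
        exact ⟨τ, ht, hiτ, by grind⟩
      have hiq : GcdAdj X i q := by
        refine ⟨h2.2, ?_⟩
        obtain ⟨τ, ht, hiτ, hjτ⟩ := hX.2 i p h2.1
        obtain ⟨m, hm⟩ := h3 τ ht hiτ
        simp only [Finset.mem_inter, Finset.mem_insert, Finset.mem_singleton] at hm
        exact ⟨τ, ht, hiτ, by grind⟩
      rw [hT, Finset.mem_filter]
      refine ⟨Finset.mem_univ _, ⟨i, p, q, hip, hpq, hiq, h1⟩, ?_, ?_⟩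
      · rintro m ⟨hm1, hm2⟩
        refine hiso.1 m ⟨fun h => hm1 (h1 ▸ Finset.mem_insert_of_mem h), fun h => hm2 ?_⟩
        simp only [Nbhd, Finset.mem_filter, Finset.mem_univ, true_and] at h ⊢
        obtain ⟨x, hx, hx2⟩ := h
        exact ⟨x, h1 ▸ Finset.mem_insert_of_mem hx, hx2⟩
      · rintro θ m ⟨hm1, hm2⟩ he
        have hθ : ∀ x, x ∈ θ ↔ x ≠ m ∧ x ∈ s := by
          intro x
          rw [← he]
          simp only [Finset.mem_insert]
          grind
        have hms : m ∈ s := he ▸ Finset.mem_insert_self _ _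
        have hmm : ∀ x ∈ s, ¬ GcdAdj X x m := by
          intro x hx hadj
          apply hm2
          simp only [Nbhd, Finset.mem_filter, Finset.mem_univ, true_and]
          exact ⟨x, (hθ x).2 ⟨hadj.1, hx⟩, hadj⟩
        simp only [h1, Finset.mem_insert, Finset.mem_singleton] at hms hmm
        rcases hms with rfl | rfl | rfl
        · exact hmm p (by simp) (adj_symm hip)
        · exact hmm i (by simp) hip
        · exact hmm i (by simp) hiq
  -- exactness
  have hrank : 2 ^ (n - 1) ≤ Module.finrank k (LinearMap.range M.mulVecLin) := by
    have h1 : (M.submatrix f g).rank = 2 ^ (n - 1) := by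
      rw [Matrix.rank_of_isUnit _ ((Matrix.isUnit_iff_isUnit_det _).2 (isUnit_iff_ne_zero.2 hdet))]
      simp
    rw [← h1]
    exact Matrix.rank_submatrix_le M f g
  have hle : LinearMap.range M.mulVecLin ≤ LinearMap.ker M.mulVecLin := by
    rintro _ ⟨v, rfl⟩
    rw [LinearMap.mem_ker, Matrix.mulVecLin_apply, Matrix.mulVecLin_apply]
    exact taylor_sq X hex a v
  have hrn := LinearMap.finrank_range_add_finrank_ker M.mulVecLin
  have hcd : Module.finrank k (Finset (Fin n) → k) = 2 ^ (n - 1) + 2 ^ (n - 1) := by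
    rw [Module.finrank_fintype_fun_eq_card, Fintype.card_finset, Fintype.card_fin]
    obtain ⟨m, rfl⟩ : ∃ m, n = m + 1 := ⟨n - 1, by omega⟩
    simp [pow_succ]
    ring
  have heq : LinearMap.range M.mulVecLin = LinearMap.ker M.mulVecLin :=
    Submodule.eq_of_le_of_finrank_le hle (by omega)
  -- dimension count
  let A : Matrix E T k := M.submatrix Subtype.val Subtype.val
  have hsurj : Function.Surjective A.mulVecLin := by
    intro u
    let w : Finset (Fin n) → k := fun s => if h : s ∈ E then u ⟨s, h⟩ else 0
    have hw : w ∈ LinearMap.ker M.mulVecLin := by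
      rw [LinearMap.mem_ker, Matrix.mulVecLin_apply]
      ext r
      rw [Matrix.mulVec, dotProduct, Pi.zero_apply]
      refine Finset.sum_eq_zero fun s _ => ?_
      by_cases h : s ∈ E
      · rw [hcol s h, zero_mul]
      · simp [w, h]
    rw [← heq] at hw
    obtain ⟨v, hv⟩ := hw
    refine ⟨fun t => v t.1, ?_⟩
    ext ⟨σ, hσ⟩
    have h1 : u ⟨σ, hσ⟩ = M.mulVecLin v σ := by
      rw [hv]
      simp [w, hσ]
    rw [h1, Matrix.mulVecLin_apply, Matrix.mulVecLin_apply, Matrix.mulVec, Matrix.mulVec,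
      dotProduct, dotProduct]
    have h2 : ∑ s, M σ s * v s = ∑ s ∈ T, M σ s * v s := by
      symm
      apply Finset.sum_subset (Finset.subset_univ _)
      intro s _ hs
      rw [hrow σ hσ s hs, zero_mul]
    rw [h2, ← Finset.sum_coe_sort T]
    rfl
  have hfin := LinearMap.finrank_le_finrank_of_surjective hsurj
  rw [Module.finrank_fintype_fun_eq_card, Module.finrank_fintype_fun_eq_card,
    Fintype.card_coe, Fintype.card_coe] at hfin
  omega
end
end
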